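/- Let 𝒦 = (K,𝒜) be a system of isometries on a compact ℝ-tree K with independent generators. Then the map 𝒬_𝒦 : ∂F(𝒜) → T̂_𝒦 (with the observers' topology on T̂_𝒦) is F(𝒜)-equivariant and continuous, and for every point P ∈ T_𝒦, 𝒬_𝒦 defines the continuous extension to F(𝒜) ∪ ∂F(𝒜) of the map F(𝒜) → T̂_𝒦, w ↦ wP. -/

import Mathlib

/-!
Common formalization framework for "ℝ-trees, dual laminations, and compact systems
of partial isometries" (Coulbois–Hilion–Lustig).
-/

open Set Filter Topology Pointwise

noncomputable section

namespace CHL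

/-! ### ℝ-trees -/

/-- The metric betweenness segment `[x,y]`.  In an ℝ-tree this is exactly the unique
topological arc joining `x` to `y`, which is a geodesic segment. -/
def seg {T : Type*} [MetricSpace T] (x y : T) : Set T :=
  {z | dist x z + dist z y = dist x y}

/-- An ℝ-tree: a geodesic metric space which is `0`-hyperbolic (four point condition).
Equivalently, any two points are joined by a unique topological arc, and this arc is a
geodesic segment. -/
class IsRTree (T : Type*) [MetricSpace T] : Prop where
  geodesic : ∀ x y : T, ∃ f : ℝ → T, f 0 = x ∧ f (dist x y) = y ∧
      ∀ s ∈ Set.Icc (0 : ℝ) (dist x y), ∀ t ∈ Set.Icc (0 : ℝ) (dist x y),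
        dist (f s) (f t) = |s - t|
  four_point : ∀ x y z w : T,
      dist x y + dist z w ≤ max (dist x z + dist y w) (dist x w + dist y z)

/-- A subtree of an ℝ-tree: a convex subset. -/
def IsSubtree {T : Type*} [MetricSpace T] (A : Set T) : Prop :=
  ∀ x ∈ A, ∀ y ∈ A, seg x y ⊆ A

/-- A non-empty closed subtree. -/
def IsClosedSubtree {T : Type*} [MetricSpace T] (A : Set T) : Prop :=
  A.Nonempty ∧ IsClosed A ∧ IsSubtree A

/-- The convex hull of a subset of an ℝ-tree: the smallest subtree containing it. -/
def subtreeHull {T : Type*} [MetricSpace T] (S : Set T) : Set T :=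
  ⋂₀ {A : Set T | S ⊆ A ∧ IsSubtree A}

/-- A finite tree: the convex hull of finitely many points. -/
def IsFiniteSubtree {T : Type*} [MetricSpace T] (A : Set T) : Prop :=
  ∃ F : Finset T, A = subtreeHull (F : Set T)

/-- `[x,x']` is the segment joining `A` to `B`: its endpoints are the only points
in `A` resp. `B` that it meets. -/
def IsBridge {T : Type*} [MetricSpace T] (A B : Set T) (x x' : T) : Prop :=
  x ∈ A ∧ x' ∈ B ∧ seg x x' ∩ A = {x} ∧ seg x x' ∩ B = {x'}

/-- A morphism of ℝ-trees: a continuous map such that every segment is mapped locally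
injectively except at finitely many points. -/
def IsTreeMorphism {T T' : Type*} [MetricSpace T] [MetricSpace T'] (f : T → T') : Prop :=
  Continuous f ∧ ∀ x y : T, ∃ F : Finset T, ∀ p ∈ seg x y, p ∉ (F : Set T) →
    ∃ U ∈ nhdsWithin p (seg x y), Set.InjOn f U

/-- The translation length `‖g‖_T = inf_{x ∈ T} d(x, gx)`. -/
def translationLength (G : Type*) [Group G] (T : Type*) [MetricSpace T] [MulAction G T]
    (g : G) : ℝ :=
  ⨅ x : T, dist x (g • x)

/-- The translation length of `g` on an invariant subtree `A`. -/
def translationLengthOn {G : Type*} [Group G] {T : Type*} [MetricSpace T] [MulAction G T]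
    (A : Set T) (g : G) : ℝ :=
  ⨅ x : A, dist (x : T) (g • (x : T))

/-- The minimal `G`-invariant subtree. -/
def minSubtree (G : Type*) [Group G] (T : Type*) [MetricSpace T] [MulAction G T] : Set T :=
  ⋂₀ {A : Set T | A.Nonempty ∧ IsSubtree A ∧ ∀ g : G, ∀ x ∈ A, g • x ∈ A}

/-! ### Free groups, reduced words and the boundary `∂F(𝒜)` -/

/-- Two letters of `𝒜^{±1}` are inverse to each other. -/
def LettersInv {ι : Type*} (a b : ι × Bool) : Prop := a.1 = b.1 ∧ a.2 = !b.2

/-- The prefix of length `n` of (the reduced word of) `w`. -/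
def gprefix {ι : Type*} [DecidableEq ι] (w : FreeGroup ι) (n : ℕ) : FreeGroup ι :=
  FreeGroup.mk (w.toWord.take n)

/-- An infinite reduced word in the letters `𝒜^{±1}`: a point of the Gromov boundary
`∂F(𝒜)` of the free group `F(𝒜)`. -/
structure InfWord (ι : Type*) where
  letter : ℕ → ι × Bool
  reduced : ∀ n, ¬ LettersInv (letter n) (letter (n + 1))

/-- The prefix `X_n` of length `n` of an infinite reduced word `X`. -/
def InfWord.prefixN {ι : Type*} (X : InfWord ι) (n : ℕ) : FreeGroup ι :=
  FreeGroup.mk (List.ofFn fun i : Fin n => X.letter i)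

/-- The infinite word `X_k⁻¹ X` obtained by deleting the first `k` letters. -/
def InfWord.shift {ι : Type*} (X : InfWord ι) (k : ℕ) : InfWord ι :=
  ⟨fun n => X.letter (k + n), fun n => X.reduced (k + n)⟩

/-- A sequence `wₙ ∈ F(𝒜)` converges in `F(𝒜) ∪ ∂F(𝒜)` to the infinite word `X` iff
the length of the maximal common prefix of `wₙ` and `X` tends to infinity. -/
def TendstoBoundary {ι : Type*} [DecidableEq ι] (w : ℕ → FreeGroup ι) (X : InfWord ι) : Prop :=
  ∀ k : ℕ, ∀ᶠ n in atTop, (w n).toWord.take k = List.ofFn fun i : Fin k => X.letter i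

/-- `Y = w · X` for the left action of `F(𝒜)` on its boundary `∂F(𝒜)`. -/
def SmulBoundary {ι : Type*} [DecidableEq ι] (w : FreeGroup ι) (X Y : InfWord ι) : Prop :=
  TendstoBoundary (fun n => w * X.prefixN n) Y

/-- The (Cantor set) topology on `∂F(𝒜)`, induced by the product topology on sequences
of letters. -/
instance {ι : Type*} : TopologicalSpace (InfWord ι) :=
  TopologicalSpace.induced (fun X => X.letter)
    (@Pi.topologicalSpace ℕ (fun _ => ι × Bool) fun _ => ⊥)

/-- A non-trivial element of `F(𝒜)` is cyclically reduced if the first letter of its reduced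
word is not the inverse of its last letter. -/
def IsCyclicallyReduced {ι : Type*} [DecidableEq ι] (w : FreeGroup ι) : Prop :=
  w ≠ 1 ∧ ∀ a ∈ w.toWord.head?, ∀ b ∈ w.toWord.getLast?, ¬ LettersInv a b

/-- The dual laminary language `ℒ_𝒜(T)` of an isometric action of `F(𝒜)` on `T`. -/
def dualLanguage (ι : Type*) [DecidableEq ι] (T : Type*) [MetricSpace T]
    [MulAction (FreeGroup ι) T] : Set (FreeGroup ι) :=
  {v | ∀ ε > (0 : ℝ), ∃ u w : FreeGroup ι,
      (u * v * w).toWord = u.toWord ++ v.toWord ++ w.toWord ∧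
      IsCyclicallyReduced (u * v * w) ∧
      translationLength (FreeGroup ι) T (u * v * w) < ε}

/-- The dual laminary language `ℒ_𝒜(T)`, for the action restricted to an invariant
subtree `A`. -/
def dualLanguageOn (ι : Type*) [DecidableEq ι] {T : Type*} [MetricSpace T]
    [MulAction (FreeGroup ι) T] (A : Set T) : Set (FreeGroup ι) :=
  {v | ∀ ε > (0 : ℝ), ∃ u w : FreeGroup ι,
      (u * v * w).toWord = u.toWord ++ v.toWord ++ w.toWord ∧
      IsCyclicallyReduced (u * v * w) ∧
      translationLengthOn A (u * v * w) < ε}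

/-! ### Systems of isometries on a compact ℝ-tree -/

/-- A system of isometries `𝒦 = (K, 𝒜)`: a family, indexed by `ι`, of non-empty partial
isometries of the compact ℝ-tree `K`, i.e. isometries between non-empty closed subtrees. -/
structure SystemOfIsometries (K : Type*) [MetricSpace K] (ι : Type*) where
  pe : ι → PartialEquiv K K
  isom : ∀ i, ∀ x ∈ (pe i).source, ∀ y ∈ (pe i).source, dist (pe i x) (pe i y) = dist x y
  source_subtree : ∀ i, IsClosedSubtree (pe i).source
  target_subtree : ∀ i, IsClosedSubtree (pe i).target

namespace SystemOfIsometries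

variable {K : Type*} [MetricSpace K] {ι : Type*} (S : SystemOfIsometries K ι)

/-- The partial isometry associated to a letter in `𝒜^{±1}`. -/
def letterPE : ι × Bool → PartialEquiv K K
  | (i, true) => S.pe i
  | (i, false) => (S.pe i).symm

/-- The partial isometry `z₁ ∘ z₂ ∘ ⋯ ∘ zₙ` (acting on the right: first `z₁`, then `z₂`, …)
associated to the reduced word `w = z₁ ⋯ zₙ ∈ F(𝒜)`. -/
def wordPE [DecidableEq ι] (w : FreeGroup ι) : PartialEquiv K K :=
  (w.toWord.map S.letterPE).foldl PartialEquiv.trans (PartialEquiv.refl K)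

/-- The domain `dom (w)` of the partial isometry associated to `w`. -/
def dom [DecidableEq ι] (w : FreeGroup ι) : Set K := (S.wordPE w).source

/-- A word is admissible if it is non-empty as a partial isometry of `K`. -/
def Admissible [DecidableEq ι] (w : FreeGroup ι) : Prop := (S.dom w).Nonempty

/-- An infinite word is admissible if all its prefixes are admissible. -/
def AdmissibleInf [DecidableEq ι] (X : InfWord ι) : Prop := ∀ n, S.Admissible (X.prefixN n)

/-- The domain of an infinite word: the intersection of the domains of its prefixes. -/
def domInf [DecidableEq ι] (X : InfWord ι) : Set K := ⋂ n, S.dom (X.prefixN n)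

/-- An infinite word `X` is eventually admissible if some suffix `X_k⁻¹ X` is admissible. -/
def EventuallyAdmissible [DecidableEq ι] (X : InfWord ι) : Prop :=
  ∃ k, S.AdmissibleInf (X.shift k)

/-- The system `𝒦` has independent generators if the (non-empty) domain of every
admissible infinite word consists of exactly one point. -/
def IndependentGenerators [DecidableEq ι] : Prop :=
  ∀ X : InfWord ι, S.AdmissibleInf X → ∃ x : K, S.domInf X = {x}

/-- The admissible laminary language `ℒ_adm(𝒦)`: the largest laminary language consisting of
admissible words; `w ∈ ℒ_adm(𝒦)` iff for every `k` the word `w` is obtained from some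
admissible word `v` by deleting its prefix and its suffix of length `k`. -/
def admLanguage [DecidableEq ι] : Set (FreeGroup ι) :=
  {w | ∀ k : ℕ, ∃ v : FreeGroup ι, S.Admissible v ∧
      ∃ p s : List (ι × Bool), p.length = k ∧ s.length = k ∧
        v.toWord = p ++ w.toWord ++ s}

end SystemOfIsometries

/-- The ℝ-tree `T_𝒦` associated to a system of isometries `𝒦 = (K, 𝒜)`, presented through
its characteristic properties (Theorem 3.2 of the paper, by which it is unique):
`T_𝒦` contains `K` as an isometrically embedded subtree (1); the left action of `F(𝒜)`
is compatible with the partial isometries (2); every orbit meets `K`, and indeed every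
segment is covered by finitely many translates of `K` (3); and `T_𝒦` is universal among
trees satisfying (1) and (2), via unique equivariant morphisms (4). -/
structure AssocTree {K : Type} [MetricSpace K] {ι : Type} [DecidableEq ι]
    (S : SystemOfIsometries K ι) where
  carrier : Type
  [ms : MetricSpace carrier]
  tree : IsRTree carrier
  [act : MulAction (FreeGroup ι) carrier]
  act_isom : ∀ g : FreeGroup ι, Isometry fun x : carrier => g • x
  emb : K → carrier
  emb_isom : Isometry emb
  emb_subtree : IsSubtree (Set.range emb)
  compat : ∀ i : ι, ∀ x ∈ (S.pe i).source, (FreeGroup.of i)⁻¹ • emb x = emb (S.pe i x)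
  orbit_meets : ∀ p : carrier, ∃ (w : FreeGroup ι) (x : K), p = w • emb x
  seg_cover : ∀ p q : carrier, ∃ F : Finset (FreeGroup ι),
      seg p q ⊆ ⋃ w ∈ F, w • Set.range emb
  universal : ∀ (T' : Type) [MetricSpace T'] [MulAction (FreeGroup ι) T'],
      (∀ g : FreeGroup ι, Isometry fun x : T' => g • x) →
      ∀ e' : K → T', Isometry e' →
      (∀ i : ι, ∀ x ∈ (S.pe i).source, (FreeGroup.of i)⁻¹ • e' x = e' (S.pe i x)) →
      ∃! f : carrier → T', IsTreeMorphism f ∧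
        (∀ (g : FreeGroup ι) (p : carrier), f (g • p) = g • f p) ∧
        ∀ x : K, f (emb x) = e' x

attribute [instance] AssocTree.ms AssocTree.act

/-! ### Very small minimal actions with dense orbits, and their metric completion -/

/-- An ℝ-tree `T` (here: the subtree `Tsub` of the complete ℝ-tree `Tb`, whose metric
completion `T̄` is `Tb`) with a very small, minimal, isometric action of the free group
`F(𝒜)` with dense orbits.  (For actions with dense orbits, "very small" is equivalent to
"trivial arc stabilizers".) -/
structure TreeSetup (ι : Type) where
  Tb : Type
  [ms : MetricSpace Tb]
  complete : CompleteSpace Tb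
  tree : IsRTree Tb
  [act : MulAction (FreeGroup ι) Tb]
  act_isom : ∀ g : FreeGroup ι, Isometry fun x : Tb => g • x
  Tsub : Set Tb
  nonempty : Tsub.Nonempty
  dense : Dense Tsub
  sub_subtree : IsSubtree Tsub
  invariant : ∀ g : FreeGroup ι, ∀ x ∈ Tsub, g • x ∈ Tsub
  minimal : ∀ A : Set Tb, A ⊆ Tsub → A.Nonempty → IsSubtree A →
      (∀ g : FreeGroup ι, ∀ x ∈ A, g • x ∈ A) → A = Tsub
  dense_orbits : ∀ x ∈ Tsub, Tsub ⊆ closure (Set.range fun g : FreeGroup ι => g • x)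
  arc_stab : ∀ g : FreeGroup ι, ∀ x ∈ Tsub, ∀ y ∈ Tsub, x ≠ y →
      (fun p => g • p) '' seg x y = seg x y → g = 1

attribute [instance] TreeSetup.ms TreeSetup.act

/-- `𝒬(X) = Q` (for `Q ∈ T̄`), where `𝒬 : ∂F_N → T̂` is the map of Levitt–Lustig:
it is characterized by the property that whenever a sequence `uₙ ∈ F_N` converges to
`X ∈ ∂F_N` and `uₙ P` converges metrically in `T̄` to a point `Q`, then `𝒬(X) = Q`. -/
def QRel {ι : Type} [DecidableEq ι] (St : TreeSetup ι) (X : InfWord ι) (Q : St.Tb) : Prop :=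
  ∃ P ∈ St.Tsub, ∃ u : ℕ → FreeGroup ι, TendstoBoundary u X ∧
    Tendsto (fun n => u n • P) atTop (𝓝 Q)

/-- The limit set `Ω_𝒜 = 𝒬²(C²_𝒜 ∩ L²(T)) ⊆ T̄`: images of pairs of distinct boundary
points with distinct first letters (w.r.t. the basis `𝒜`) that are identified by `𝒬`. -/
def limitSet {ι : Type} [DecidableEq ι] (St : TreeSetup ι) : Set St.Tb :=
  {Q | ∃ X Y : InfWord ι, X.letter 0 ≠ Y.letter 0 ∧ QRel St X Q ∧ QRel St Y Q}

/-- The heart `K_𝒜 ⊆ T̄`: the convex hull of the limit set `Ω_𝒜`. -/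
def heart {ι : Type} [DecidableEq ι] (St : TreeSetup ι) : Set St.Tb :=
  subtreeHull (limitSet St)

/-- The dual algebraic lamination `L²(T) = {(X,Y) ∈ ∂²F_N : 𝒬(X) = 𝒬(Y)}`. -/
def L2 {ι : Type} [DecidableEq ι] (St : TreeSetup ι) : Set (InfWord ι × InfWord ι) :=
  {p | p.1 ≠ p.2 ∧ ∃ Q : St.Tb, QRel St p.1 Q ∧ QRel St p.2 Q}

/-! ### The system of isometries induced on a compact subtree `K ⊆ T̄` -/

/-- The domain, inside `T̄`, of the partial isometry `x ↦ w⁻¹ x` of `K` induced by the word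
`w`: the intersection of the translates of `K` by the prefixes of `w`. -/
def inducedDom {ι : Type} [DecidableEq ι] (St : TreeSetup ι) (K : Set St.Tb)
    (w : FreeGroup ι) : Set St.Tb :=
  ⋂ n ∈ Finset.range (w.toWord.length + 1), gprefix w n • K

/-- Admissibility of a word for the induced system of isometries `𝒦 = (K, 𝒜)`. -/
def InducedAdmissible {ι : Type} [DecidableEq ι] (St : TreeSetup ι) (K : Set St.Tb)
    (w : FreeGroup ι) : Prop :=
  (inducedDom St K w).Nonempty

/-- The admissible laminary language `ℒ_adm(𝒦)` of the induced system `𝒦 = (K, 𝒜)`. -/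
def inducedAdmLanguage {ι : Type} [DecidableEq ι] (St : TreeSetup ι) (K : Set St.Tb) :
    Set (FreeGroup ι) :=
  {w | ∀ k : ℕ, ∃ v : FreeGroup ι, InducedAdmissible St K v ∧
      ∃ p s : List (ι × Bool), p.length = k ∧ s.length = k ∧
        v.toWord = p ++ w.toWord ++ s}

/-- Admissibility of an infinite word for the induced system `𝒦 = (K, 𝒜)`. -/
def InducedAdmissibleInf {ι : Type} [DecidableEq ι] (St : TreeSetup ι) (K : Set St.Tb)
    (X : InfWord ι) : Prop :=
  ∀ n, InducedAdmissible St K (X.prefixN n)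

/-- The domain `dom(X) = ⋂ₙ dom(Xₙ)` of an infinite word, for the induced system. -/
def inducedDomInf {ι : Type} [DecidableEq ι] (St : TreeSetup ι) (K : Set St.Tb)
    (X : InfWord ι) : Set St.Tb :=
  ⋂ n, X.prefixN n • K

/-- Compatibility of a map `e : K → T'` with the system of partial isometries induced on
`K ⊆ T̄` by the basis `𝒜`: this is condition (2) of Theorem 3.2 for the induced system. -/
def InducedCompat {ι : Type} (St : TreeSetup ι) (K : Set St.Tb) {T' : Type} [MetricSpace T']
    [MulAction (FreeGroup ι) T'] (e : K → T') : Prop :=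
  ∀ (i : ι) (x : K) (h : (FreeGroup.of i)⁻¹ • (x : St.Tb) ∈ K),
    (FreeGroup.of i)⁻¹ • e x = e ⟨(FreeGroup.of i)⁻¹ • (x : St.Tb), h⟩

/-- The tree `T_𝒦` associated to the system of isometries induced on a compact subtree
`K ⊆ T̄`, presented through the characteristic properties of Theorem 3.2 (by which it is
unique), together with the canonical `F(𝒜)`-equivariant morphism `j : T_𝒦 → T̄` restricting
to the identity on `K`. -/
structure InducedAssoc {ι : Type} (St : TreeSetup ι) (K : Set St.Tb) where
  TK : Type
  [ms : MetricSpace TK]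
  tree : IsRTree TK
  [act : MulAction (FreeGroup ι) TK]
  act_isom : ∀ g : FreeGroup ι, Isometry fun x : TK => g • x
  emb : K → TK
  emb_isom : Isometry emb
  emb_subtree : IsSubtree (Set.range emb)
  compat : InducedCompat St K emb
  orbit_meets : ∀ p : TK, ∃ (w : FreeGroup ι) (x : K), p = w • emb x
  seg_cover : ∀ p q : TK, ∃ F : Finset (FreeGroup ι),
      seg p q ⊆ ⋃ w ∈ F, w • Set.range emb
  universal : ∀ (T' : Type) [MetricSpace T'] [MulAction (FreeGroup ι) T'],
      (∀ g : FreeGroup ι, Isometry fun x : T' => g • x) →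
      ∀ e' : K → T', Isometry e' → InducedCompat St K e' →
      ∃! f : TK → T', IsTreeMorphism f ∧
        (∀ (g : FreeGroup ι) (p : TK), f (g • p) = g • f p) ∧
        ∀ x : K, f (emb x) = e' x
  jmap : TK → St.Tb
  jmap_morphism : IsTreeMorphism jmap
  jmap_equivariant : ∀ (g : FreeGroup ι) (p : TK), jmap (g • p) = g • jmap p
  jmap_emb : ∀ x : K, jmap (emb x) = (x : St.Tb)

attribute [instance] InducedAssoc.ms InducedAssoc.act

/-! ### Change of basis -/

/-- Changing the basis of the free group: the same tree, with the action precomposed with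
the automorphism `φ` of `F(𝒜)`.  The heart of `St.twist φ` is the heart of `T` with respect
to the basis `φ(𝒜)`. -/
def TreeSetup.twist {ι : Type} (St : TreeSetup ι) (φ : FreeGroup ι ≃* FreeGroup ι) :
    TreeSetup ι where
  Tb := St.Tb
  ms := St.ms
  complete := St.complete
  tree := St.tree
  act := { smul := fun g x => φ g • x
           one_smul := fun x => by show φ 1 • x = x; rw [map_one, one_smul]
           mul_smul := fun g h x => by
             show φ (g * h) • x = φ g • φ h • x
             rw [map_mul, mul_smul] }
  act_isom := fun g => St.act_isom (φ g)
  Tsub := St.Tsub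
  nonempty := St.nonempty
  dense := St.dense
  sub_subtree := St.sub_subtree
  invariant := fun g x hx => St.invariant (φ g) x hx
  minimal := fun A hA hne hsub hinv => St.minimal A hA hne hsub (fun g x hx => by
    have h : φ (φ.symm g) • x ∈ A := hinv (φ.symm g) x hx
    rwa [MulEquiv.apply_symm_apply] at h)
  dense_orbits := fun x hx => by
    have hr : (Set.range fun g : FreeGroup ι => φ g • x) =
        Set.range fun g : FreeGroup ι => g • x := by
      apply Set.ext; intro y
      constructor
      · rintro ⟨g, rfl⟩; exact ⟨φ g, rfl⟩
      · rintro ⟨g, rfl⟩; exact ⟨φ.symm g, by simp⟩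
    show St.Tsub ⊆ closure (Set.range fun g : FreeGroup ι => φ g • x)
    rw [hr]; exact St.dense_orbits x hx
  arc_stab := fun g x hx y hy hxy him => by
    have h1 : φ g = 1 := St.arc_stab (φ g) x hx y hy hxy him
    have h2 := congrArg φ.symm h1
    simpa using h2

/-! ### The boundary `∂T`, the space `T̂ = T̄ ∪ ∂T` and the observers' topology -/

/-- An isometric ray (parametrized on `[0,∞)`) in a metric space. -/
def IsRay {T : Type} [MetricSpace T] (r : ℝ → T) : Prop :=
  ∀ s t : ℝ, 0 ≤ s → 0 ≤ t → dist (r s) (r t) = |s - t|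

/-- The type of isometric rays in `T`. -/
def Ray (T : Type) [MetricSpace T] : Type := {r : ℝ → T // IsRay r}

/-- Two rays define the same end iff they are at bounded distance. -/
def rayEnd (T : Type) [MetricSpace T] : Setoid (Ray T) where
  r := fun r₁ r₂ => ∃ C : ℝ, ∀ t : ℝ, 0 ≤ t → dist (r₁.1 t) (r₂.1 t) ≤ C
  iseqv := by
    refine ⟨fun r => ⟨0, fun t _ => by simp⟩, ?_, ?_⟩
    · rintro r₁ r₂ ⟨C, hC⟩
      exact ⟨C, fun t ht => by rw [dist_comm]; exact hC t ht⟩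
    · rintro r₁ r₂ r₃ ⟨C, hC⟩ ⟨D, hD⟩
      exact ⟨C + D, fun t ht =>
        (dist_triangle _ (r₂.1 t) _).trans (add_le_add (hC t ht) (hD t ht))⟩

/-- The Gromov boundary `∂T`: ends of `T`, i.e. classes of rays at bounded distance. -/
def GromovBoundary (T : Type) [MetricSpace T] : Type := Quotient (rayEnd T)

/-- The space `T̂ = T̄ ∪ ∂T` (for `T` a complete ℝ-tree, representing the completion `T̄`). -/
def TreeHat (T : Type) [MetricSpace T] : Type := T ⊕ GromovBoundary T

/-- The segment `[x, ξ]` from a point `x ∈ T̄` to a boundary point `ξ ∈ ∂T`. -/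
def raySeg {T : Type} [MetricSpace T] (x : T) (ξ : GromovBoundary T) : Set (TreeHat T) :=
  ({Sum.inr ξ} : Set (TreeHat T)) ∪ Sum.inl ''
    {p | ∃ r : Ray T, Quotient.mk (rayEnd T) r = ξ ∧ r.1 0 = x ∧ ∃ t : ℝ, 0 ≤ t ∧ r.1 t = p}

/-- The segment `[ξ, η]` between two boundary points. -/
def lineSeg {T : Type} [MetricSpace T] (ξ η : GromovBoundary T) : Set (TreeHat T) :=
  ({Sum.inr ξ, Sum.inr η} : Set (TreeHat T)) ∪ Sum.inl ''
    {p | ∃ r r' : Ray T, Quotient.mk (rayEnd T) r = ξ ∧ Quotient.mk (rayEnd T) r' = η ∧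
      r.1 0 = p ∧ r'.1 0 = p ∧ ∀ s t : ℝ, 0 ≤ s → 0 ≤ t → dist (r.1 s) (r'.1 t) = s + t}

/-- The segment `[P, Q]` between two points of `T̂ = T̄ ∪ ∂T`. -/
def segHat {T : Type} [MetricSpace T] : TreeHat T → TreeHat T → Set (TreeHat T)
  | Sum.inl x, Sum.inl y => Sum.inl '' seg x y
  | Sum.inl x, Sum.inr ξ => raySeg x ξ
  | Sum.inr ξ, Sum.inl x => raySeg x ξ
  | Sum.inr ξ, Sum.inr η => lineSeg ξ η

/-- The observers' topology on `T̂`: generated by the set of directions, where the direction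
at `P` containing `x` is the set of points `y` with `P ∉ [x,y]` (i.e. the connected component
of `T̂ ∖ {P}` containing `x`). -/
def observersTopology (T : Type) [MetricSpace T] : TopologicalSpace (TreeHat T) :=
  TopologicalSpace.generateFrom
    {D | ∃ P x : TreeHat T, x ≠ P ∧ D = {y | y ≠ P ∧ P ∉ segHat x y}}

/-- The extension to `T̂ = T̄ ∪ ∂T` of an isometric action on `T̄`. -/
def TreeHat.smul {T : Type} [MetricSpace T] {G : Type} [Group G] [MulAction G T]
    (hiso : ∀ g : G, Isometry fun x : T => g • x) (g : G) : TreeHat T → TreeHat T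
  | Sum.inl x => Sum.inl (g • x)
  | Sum.inr ξ => Sum.inr <| Quotient.map'
      (fun r : Ray T => (⟨fun t => g • r.1 t, fun s t hs ht => by
        have h := (hiso g).dist_eq (r.1 s) (r.1 t)
        simpa using h.trans (r.2 s t hs ht)⟩ : Ray T))
      (fun r r' h => by
        obtain ⟨C, hC⟩ := h
        exact ⟨C, fun t ht => by
          have h' := (hiso g).dist_eq (r.1 t) (r'.1 t)
          simpa using h'.le.trans (hC t ht)⟩) ξ

/-! ### Laminations -/

/-- An algebraic lamination (as a set of pairs of boundary points) is closed by diagonal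
leaves. -/
def ClosedByDiagonal {ι : Type} (L : Set (InfWord ι × InfWord ι)) : Prop :=
  ∀ X X' X'' : InfWord ι, (X, X') ∈ L → (X', X'') ∈ L → X = X'' ∨ (X, X'') ∈ L

/-- Invariance of a lamination under the `F(𝒜)`-action on `∂²F(𝒜)`. -/
def InvariantLam {ι : Type} [DecidableEq ι] (L : Set (InfWord ι × InfWord ι)) : Prop :=
  ∀ (w : FreeGroup ι) (X X' Y Y' : InfWord ι), (X, X') ∈ L →
    SmulBoundary w X Y → SmulBoundary w X' Y' → (Y, Y') ∈ L

/-- Invariance of a lamination under the flip map. -/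
def FlipInvariant {ι : Type} (L : Set (InfWord ι × InfWord ι)) : Prop :=
  ∀ X Y : InfWord ι, (X, Y) ∈ L → (Y, X) ∈ L

/-- The dual lamination `L²(T)` is minimal up to diagonal leaves: it contains no proper
non-trivial sublamination that is closed by diagonal leaves. -/
def MinimalUpToDiagonal {ι : Type} [DecidableEq ι] (St : TreeSetup ι) : Prop :=
  ∀ L : Set (InfWord ι × InfWord ι), L ⊆ L2 St → L.Nonempty → IsClosed L →
    InvariantLam L → FlipInvariant L → ClosedByDiagonal L → L = L2 St

end CHL

namespace CHL

section Tree

variable {T : Type*} [MetricSpace T]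

theorem mem_seg {x y z : T} : z ∈ seg x y ↔ dist x z + dist z y = dist x y := Iff.rfl

theorem seg_comm (x y : T) : seg x y = seg y x := by
  ext z
  rw [mem_seg, mem_seg, dist_comm x z, dist_comm z y, dist_comm x y, add_comm]

theorem left_mem_seg (x y : T) : x ∈ seg x y := by simp [mem_seg]

theorem right_mem_seg (x y : T) : y ∈ seg x y := by simp [mem_seg]

theorem mem_seg_self {x p : T} : p ∈ seg x x ↔ p = x := by
  refine ⟨fun h => ?_, fun h => h ▸ left_mem_seg _ _⟩
  rw [mem_seg, dist_self, dist_comm x p] at h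
  exact dist_eq_zero.1 (by linarith [dist_nonneg (x := p) (y := x)])

theorem mem_seg_map_iff {T' : Type*} [MetricSpace T'] {f : T → T'} (hf : Isometry f)
    {x y z : T} : f z ∈ seg (f x) (f y) ↔ z ∈ seg x y := by
  simp only [mem_seg, hf.dist_eq]

/-- If `z ∈ [x, y]` and `p ∈ [x, z]` then `z ∈ [p, y]`. -/
theorem mem_seg_right_of_mem {x y z p : T} (hz : z ∈ seg x y) (hp : p ∈ seg x z) :
    z ∈ seg p y := by
  rw [mem_seg] at *
  linarith [dist_triangle x p y, dist_triangle p z y]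

/-- If `z ∈ [x, y]` and `p ∈ [x, z]` then `p ∈ [x, y]`. -/
theorem mem_seg_of_mem_seg_left {x y z p : T} (hz : z ∈ seg x y) (hp : p ∈ seg x z) :
    p ∈ seg x y := by
  rw [mem_seg] at *
  linarith [dist_triangle x p y, dist_triangle p z y]

variable [IsRTree T]

theorem mem_seg_or_mem_seg {x z p : T} (h : p ∈ seg x z) (y : T) :
    p ∈ seg x y ∨ p ∈ seg y z := by
  rw [mem_seg] at *
  rw [mem_seg]
  have h4 := IsRTree.four_point x z p y
  have e1 := dist_comm z y
  have e2 := dist_comm z p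
  have e3 := dist_comm p y
  rcases le_max_iff.1 h4 with h | h
  · right; linarith [dist_triangle y p z]
  · left; linarith [dist_triangle x p y]

theorem notMem_seg_trans {x y z p : T} (h : p ∉ seg x y) (h' : p ∉ seg y z) :
    p ∉ seg x z := fun hp => (mem_seg_or_mem_seg hp y).elim h h'

theorem mem_seg_congr {x y a b p : T} (h : p ∉ seg a x) (h' : p ∉ seg b y) :
    p ∈ seg a b ↔ p ∈ seg x y := by
  constructor <;> contrapose <;> intro hp
  · exact notMem_seg_trans h (notMem_seg_trans hp (by rwa [seg_comm]))
  · exact notMem_seg_trans (by rwa [seg_comm]) (notMem_seg_trans hp h')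

theorem seg_total {x y p q : T} (hp : p ∈ seg x y) (hq : q ∈ seg x y) :
    p ∈ seg x q ∨ q ∈ seg x p := by
  refine (mem_seg_or_mem_seg hp q).imp_right fun h => ?_
  rw [mem_seg] at *
  linarith [dist_triangle x q p, dist_triangle x p y, dist_comm p q]

theorem eq_of_mem_seg_of_dist_eq {x y p q : T} (hp : p ∈ seg x y) (hq : q ∈ seg x y)
    (h : dist x p = dist x q) : p = q := by
  rcases seg_total hp hq with h' | h' <;> rw [mem_seg] at h'
  · exact dist_eq_zero.1 (by linarith)
  · exact (dist_eq_zero.1 (by linarith)).symm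

theorem exists_mem_seg_dist_eq (x y : T) {s : ℝ} (h0 : 0 ≤ s) (h1 : s ≤ dist x y) :
    ∃ z ∈ seg x y, dist x z = s := by
  obtain ⟨f, hf0, hf1, hf⟩ := IsRTree.geodesic x y
  have hd : dist x (f s) = s := by
    rw [← hf0, hf 0 ⟨le_rfl, dist_nonneg⟩ s ⟨h0, h1⟩, zero_sub, abs_neg, abs_of_nonneg h0]
  refine ⟨f s, ?_, hd⟩
  have : dist (f s) y = dist x y - s := by
    rw [← hf1, hf s ⟨h0, h1⟩ _ ⟨dist_nonneg, le_rfl⟩, hf1, abs_of_nonpos (by linarith)]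
    ring
  rw [mem_seg]
  linarith

theorem isPreconnected_seg (x y : T) : IsPreconnected (seg x y) := by
  obtain ⟨f, hf0, hf1, hf⟩ := IsRTree.geodesic x y
  have key : ∀ s ∈ Icc (0 : ℝ) (dist x y), dist x (f s) = s ∧ f s ∈ seg x y := by
    intro s hs
    have hd : dist x (f s) = s := by
      rw [← hf0, hf 0 ⟨le_rfl, dist_nonneg⟩ s hs, zero_sub, abs_neg, abs_of_nonneg hs.1]
    have : dist (f s) y = dist x y - s := by
      rw [← hf1, hf s hs _ ⟨dist_nonneg, le_rfl⟩, hf1, abs_of_nonpos (by linarith [hs.2])]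
      ring
    exact ⟨hd, by rw [mem_seg]; linarith⟩
  have himg : seg x y = f '' Icc (0 : ℝ) (dist x y) := by
    ext z
    constructor
    · intro hz
      have hs : dist x z ∈ Icc (0 : ℝ) (dist x y) :=
        ⟨dist_nonneg, by rw [mem_seg] at hz; linarith [dist_nonneg (x := z) (y := y)]⟩
      exact ⟨dist x z, hs, eq_of_mem_seg_of_dist_eq (key _ hs).2 hz (key _ hs).1⟩
    · rintro ⟨s, hs, rfl⟩
      exact (key s hs).2
  rw [himg]
  refine isPreconnected_Icc.image f (LipschitzOnWith.continuousOn (K := 1) ?_)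
  refine LipschitzOnWith.of_dist_le_mul fun s hs t ht => ?_
  rw [hf s hs t ht, Real.dist_eq, NNReal.coe_one, one_mul]

theorem exists_median (x y z : T) : ∃ m, m ∈ seg x y ∧ m ∈ seg y z ∧ m ∈ seg x z := by
  have t1 := dist_triangle x y z
  have t2 := dist_triangle y x z
  have t3 := dist_triangle x z y
  have e1 := dist_comm x y
  have e2 := dist_comm y z
  have e3 := dist_comm x z
  obtain ⟨m, hm, hd⟩ := exists_mem_seg_dist_eq y z
    (s := (dist y x + dist y z - dist x z) / 2) (by linarith) (by linarith)
  have hm' := hm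
  rw [mem_seg] at hm'
  have f1 := dist_comm y m
  have f2 := dist_comm z m
  have h4 := IsRTree.four_point x m y z
  have h5 : dist x m ≤ (dist x y + dist x z - dist y z) / 2 := by
    rcases le_max_iff.1 h4 with h | h <;> linarith
  refine ⟨m, ?_, hm, ?_⟩ <;> rw [mem_seg]
  · linarith [dist_triangle x m y]
  · linarith [dist_triangle x m z]

/-- Nearest point projection onto a compact subtree. -/
theorem IsSubtree.exists_proj {C : Set T} (hC : IsSubtree C) (hcomp : IsCompact C)
    (hne : C.Nonempty) (x : T) : ∃ c ∈ C, ∀ z ∈ C, c ∈ seg x z := by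
  obtain ⟨c, hc, hmin⟩ := hcomp.exists_isMinOn hne
    (f := fun z => dist x z) (by fun_prop)
  refine ⟨c, hc, fun z hz => ?_⟩
  obtain ⟨m, hm1, hm2, hm3⟩ := exists_median x c z
  have h1 : dist x c ≤ dist x m := hmin (hC c hc z hz hm2)
  rw [mem_seg] at hm1
  have : m = c := dist_eq_zero.1 (by linarith [dist_nonneg (x := m) (y := c)])
  rwa [this] at hm3

theorem dist_proj_le {C : Set T} {x y c d : T} (hc : c ∈ C) (hd : d ∈ C)
    (hxc : ∀ z ∈ C, c ∈ seg x z) (hyd : ∀ z ∈ C, d ∈ seg y z) : dist c d ≤ dist x y := by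
  have h1 := hxc d hd
  have h2 := hyd c hc
  rw [mem_seg] at h1 h2
  have h4 := IsRTree.four_point x d y c
  have e1 := dist_comm d c
  have e2 := dist_comm d y
  rcases le_max_iff.1 h4 with h | h <;> linarith [dist_nonneg (x := x) (y := y),
    dist_nonneg (x := x) (y := c), dist_nonneg (x := y) (y := d)]

end Tree

section Rays

variable {T : Type} [MetricSpace T]

theorem IsRay.mem_seg {r : ℝ → T} (hr : IsRay r) {s t u : ℝ} (hs : 0 ≤ s) (hst : s ≤ t)
    (htu : t ≤ u) : r t ∈ seg (r s) (r u) := by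
  rw [CHL.mem_seg, hr s t hs (hs.trans hst), hr t u (hs.trans hst) (by linarith),
    hr s u hs (by linarith), abs_of_nonpos (by linarith), abs_of_nonpos (by linarith),
    abs_of_nonpos (by linarith)]
  ring

theorem IsRay.notMem_seg {r : ℝ → T} (hr : IsRay r) {p : T} {s t : ℝ}
    (hs : dist p (r 0) < s) (ht : dist p (r 0) < t) : p ∉ seg (r s) (r t) := by
  wlog hst : s ≤ t generalizing s t
  · rw [seg_comm]
    exact this ht hs (le_of_not_ge hst)
  intro hp
  have h0 : 0 ≤ s := dist_nonneg.trans hs.le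
  rw [CHL.mem_seg, hr s t h0 (h0.trans hst), abs_of_nonpos (by linarith)] at hp
  have h1 := hr 0 t le_rfl (h0.trans hst)
  rw [zero_sub, abs_neg, abs_of_nonneg (h0.trans hst)] at h1
  linarith [dist_triangle (r 0) p (r t), dist_comm p (r 0), dist_nonneg (x := r s) (y := p)]

theorem IsRay.eventually_notMem_seg {r r' : ℝ → T} (hr : IsRay r) {C : ℝ}
    (hC : ∀ t, 0 ≤ t → dist (r t) (r' t) ≤ C) (p : T) :
    ∀ᶠ t in atTop, p ∉ seg (r t) (r' t) := by
  filter_upwards [eventually_gt_atTop (C + dist p (r 0)), eventually_ge_atTop 0] with t ht h0 hp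
  have h1 := hr 0 t le_rfl h0
  rw [zero_sub, abs_neg, abs_of_nonneg h0] at h1
  rw [CHL.mem_seg] at hp
  linarith [dist_triangle (r 0) p (r t), dist_comm p (r 0), dist_comm p (r t),
    dist_nonneg (x := p) (y := r' t), hC t h0]

variable [IsRTree T]

theorem IsRay.mem_seg_iff {r : ℝ → T} (hr : IsRay r) {p : T} {t : ℝ} (ht : 0 ≤ t)
    (hp : p ∈ seg (r 0) (r t)) : r (dist (r 0) p) = p := by
  have h1 := hr 0 t le_rfl ht
  rw [zero_sub, abs_neg, abs_of_nonneg ht] at h1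
  have h2 : dist (r 0) p ≤ t := by
    rw [CHL.mem_seg] at hp
    linarith [dist_nonneg (x := p) (y := r t)]
  refine eq_of_mem_seg_of_dist_eq (hr.mem_seg le_rfl dist_nonneg h2) hp ?_
  rw [hr 0 _ le_rfl dist_nonneg, zero_sub, abs_neg, abs_of_nonneg dist_nonneg]

/-- Gluing a segment and a ray. -/
theorem exists_ray_concat {x : T} {r : ℝ → T} (hr : IsRay r)
    (h : ∀ t, 0 ≤ t → r 0 ∈ seg x (r t)) :
    ∃ ρ : ℝ → T, IsRay ρ ∧ ρ 0 = x ∧ ∀ t, 0 ≤ t → ρ (dist x (r 0) + t) = r t := by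
  obtain ⟨f, hf0, hf1, hf⟩ := IsRTree.geodesic x (r 0)
  set a := dist x (r 0) with ha
  have ha0 : 0 ≤ a := dist_nonneg
  have hfr : ∀ s, 0 ≤ s → s ≤ a → ∀ u, 0 ≤ u → dist (f s) (r u) = a + u - s := by
    intro s hs hsa u hu
    have h1 := h u hu
    have h2 := hr 0 u le_rfl hu
    have h3 := hf 0 ⟨le_rfl, ha0⟩ s ⟨hs, hsa⟩
    have h4 := hf s ⟨hs, hsa⟩ a ⟨ha0, le_rfl⟩
    rw [mem_seg] at h1
    rw [zero_sub, abs_neg, abs_of_nonneg hu] at h2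
    rw [zero_sub, abs_neg, abs_of_nonneg hs, hf0] at h3
    rw [hf1, abs_of_nonpos (by linarith)] at h4
    apply le_antisymm
    · linarith [dist_triangle (f s) (r 0) (r u)]
    · linarith [dist_triangle x (f s) (r u)]
  refine ⟨fun s => if s ≤ a then f s else r (s - a), ?_, by simp [ha0, hf0], ?_⟩
  · intro s t hs ht
    by_cases h1 : s ≤ a <;> by_cases h2 : t ≤ a <;> simp only [h1, h2, if_true, if_false]
    · exact hf s ⟨hs, h1⟩ t ⟨ht, h2⟩
    · rw [hfr s hs h1 _ (by linarith), abs_of_nonpos (by linarith)]; ring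
    · rw [dist_comm, hfr t ht h2 _ (by linarith), abs_of_nonneg (by linarith)]; ring
    · rw [hr _ _ (by linarith) (by linarith)]; congr 1; ring
  · intro t ht
    rcases ht.eq_or_lt with rfl | ht
    · simp [hf1]
    · simp [ht]

theorem exists_ray_from (x : T) (r : Ray T) :
    ∃ ρ : Ray T, ρ.1 0 = x ∧ Quotient.mk (rayEnd T) ρ = Quotient.mk (rayEnd T) r := by
  obtain ⟨r, hr⟩ := r
  set D := dist x (r 0)
  have hD : 0 ≤ D := dist_nonneg
  obtain ⟨c, hc1, hc2, hc3⟩ := exists_median x (r 0) (r (D + 1))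
  have hcD : dist (r 0) c ≤ D := by
    rw [mem_seg] at hc1
    linarith [dist_nonneg (x := x) (y := c), dist_comm c (r 0)]
  set t0 := dist (r 0) c with ht0
  have ht00 : 0 ≤ t0 := dist_nonneg
  have hrt : r t0 = c := hr.mem_seg_iff (by linarith) hc2
  have key : ∀ t, 0 ≤ t → c ∈ seg x (r (t0 + t)) := by
    intro t ht
    rcases le_total (t0 + t) (D + 1) with h | h
    · have h1 := hr.mem_seg (s := t0) (t := t0 + t) (u := D + 1) ht00 (by linarith) h
      rw [hrt, seg_comm] at h1
      rw [seg_comm] at hc3 ⊢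
      exact mem_seg_right_of_mem hc3 h1
    · refine (mem_seg_or_mem_seg hc3 _).resolve_right ?_
      apply hr.notMem_seg <;> rw [dist_comm] <;> linarith
  have hr' : IsRay fun t => r (t0 + t) := by
    intro s t hs ht
    rw [hr _ _ (by linarith) (by linarith)]; congr 1; ring
  obtain ⟨ρ, hρ, hρ0, hρr⟩ := exists_ray_concat hr' (x := x) (by simpa [hrt] using key)
  refine ⟨⟨ρ, hρ⟩, hρ0, Quotient.sound ?_⟩
  set a := dist x (r (t0 + 0))
  have ha0 : 0 ≤ a := dist_nonneg
  refine ⟨a + t0, fun t ht => ?_⟩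
  show dist (ρ t) (r t) ≤ _
  have h1 := hρ t (a + t) ht (by linarith)
  have h2 := hr (t0 + t) (t) (by linarith) ht
  rw [hρr t ht] at h1
  have h3 : |t - (a + t)| = a := by rw [abs_of_nonpos (by linarith)]; ring
  have h4 : |t0 + t - t| = t0 := by rw [abs_of_nonneg (by linarith)]; ring
  rw [h3] at h1
  rw [h4] at h2
  linarith [dist_triangle (ρ t) (r (t0 + t)) (r t)]

end Rays

section Directions

theorem inl_mem_singleton_union_iff {α β : Type*} {s : Set α} {ξ : β} {p : α} :
    (Sum.inl p : α ⊕ β) ∈ ({Sum.inr ξ} : Set (α ⊕ β)) ∪ Sum.inl '' s ↔ p ∈ s := by simp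

theorem inr_mem_singleton_union_iff {α β : Type*} {s : Set α} {ξ η : β} :
    (Sum.inr η : α ⊕ β) ∈ ({Sum.inr ξ} : Set (α ⊕ β)) ∪ Sum.inl '' s ↔ η = ξ := by simp

theorem inl_mem_pair_union_iff {α β : Type*} {s : Set α} {ξ η : β} {p : α} :
    (Sum.inl p : α ⊕ β) ∈ ({Sum.inr ξ, Sum.inr η} : Set (α ⊕ β)) ∪ Sum.inl '' s ↔ p ∈ s := by
  simp

theorem inr_mem_pair_union_iff {α β : Type*} {s : Set α} {ξ η ζ : β} :
    (Sum.inr ζ : α ⊕ β) ∈ ({Sum.inr ξ, Sum.inr η} : Set (α ⊕ β)) ∪ Sum.inl '' s ↔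
      ζ = ξ ∨ ζ = η := by simp

variable {T : Type} [MetricSpace T]

/-- The point `x` of `T` and the point `a` of `T̂` lie in the same direction at `p`. -/
def SameDir (p : T) : TreeHat T → T → Prop
  | Sum.inl a, x => p ∉ seg a x
  | Sum.inr ξ, x => ∃ r : Ray T, Quotient.mk (rayEnd T) r = ξ ∧ ∀ᶠ t in atTop, p ∉ seg (r.1 t) x

theorem sameDir_inl {p a x : T} : SameDir p (Sum.inl a) x ↔ p ∉ seg a x := Iff.rfl

theorem SameDir.smul {G : Type} [Group G] [MulAction G T]
    (hiso : ∀ g : G, Isometry fun x : T => g • x) (g : G) {p x : T} {a : TreeHat T}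
    (h : SameDir p a x) : SameDir (g • p) (TreeHat.smul hiso g a) (g • x) := by
  rcases a with a | ξ
  · exact fun hp => h ((mem_seg_map_iff (hiso g)).1 hp)
  · obtain ⟨r, rfl, hr⟩ := h
    refine ⟨_, rfl, ?_⟩
    filter_upwards [hr] with t ht hp
    exact ht ((mem_seg_map_iff (hiso g)).1 hp)

theorem SameDir.ne {p x : T} {a : TreeHat T} (h : SameDir p a x) : a ≠ Sum.inl p := by
  rintro rfl
  exact h (left_mem_seg p x)

theorem exists_sameDir {p : T} {a : TreeHat T} (h : a ≠ Sum.inl p) : ∃ x, SameDir p a x := by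
  rcases a with a | ξ
  · refine ⟨a, fun hp => h ?_⟩
    rw [mem_seg_self] at hp
    rw [hp]
  · obtain ⟨r, rfl⟩ := Quotient.exists_rep ξ
    refine ⟨r.1 (dist p (r.1 0) + 1), r, rfl, ?_⟩
    filter_upwards [eventually_gt_atTop (dist p (r.1 0))] with t ht
    exact r.2.notMem_seg ht (by linarith)

variable [IsRTree T]

theorem SameDir.eventually {p x : T} {r : Ray T}
    (h : SameDir p (Sum.inr (Quotient.mk (rayEnd T) r)) x) :
    ∀ᶠ t in atTop, p ∉ seg (r.1 t) x := by
  obtain ⟨r', hr', h⟩ := h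
  obtain ⟨C, hC⟩ := Quotient.exact hr'.symm
  filter_upwards [h, r.2.eventually_notMem_seg hC p] with t h1 h2
  exact notMem_seg_trans h2 h1

theorem SameDir.trans {p x y : T} {a : TreeHat T} (h : SameDir p a x) (h' : p ∉ seg x y) :
    SameDir p a y := by
  rcases a with a | ξ
  · exact notMem_seg_trans h h'
  · obtain ⟨r, hr, h⟩ := h
    exact ⟨r, hr, h.mono fun t ht => notMem_seg_trans ht h'⟩

theorem SameDir.notMem_seg {p x y : T} {a : TreeHat T} (h : SameDir p a x)
    (h' : SameDir p a y) : p ∉ seg x y := by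
  rcases a with a | ξ
  · refine notMem_seg_trans ?_ h'
    rw [seg_comm]
    exact h
  · obtain ⟨r, rfl⟩ := Quotient.exists_rep ξ
    obtain ⟨t, h1, h2⟩ := (h.eventually.and h'.eventually).exists
    refine notMem_seg_trans ?_ h2
    rwa [seg_comm]

theorem inl_mem_raySeg_iff {a p y : T} {ξ : GromovBoundary T} (ha : p ≠ a)
    (h : SameDir p (Sum.inr ξ) y) : Sum.inl p ∈ raySeg a ξ ↔ p ∈ seg a y := by
  have hdef : Sum.inl p ∈ raySeg a ξ ↔ ∃ r : Ray T, Quotient.mk (rayEnd T) r = ξ ∧ r.1 0 = a ∧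
      ∃ t : ℝ, 0 ≤ t ∧ r.1 t = p := inl_mem_singleton_union_iff
  rw [hdef]
  constructor
  · rintro ⟨r, rfl, rfl, s, hs, rfl⟩
    obtain ⟨t, h1, h2⟩ := (h.eventually.and (eventually_ge_atTop s)).exists
    refine (mem_seg_or_mem_seg (r.2.mem_seg le_rfl hs h2) y).resolve_right ?_
    rwa [seg_comm]
  · intro hp
    obtain ⟨r, rfl⟩ := Quotient.exists_rep ξ
    obtain ⟨ρ, rfl, hρ⟩ := exists_ray_from a r
    rw [← hρ] at h ⊢
    obtain ⟨t, h1, h2⟩ := (h.eventually.and (eventually_ge_atTop 0)).exists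
    exact ⟨ρ, rfl, rfl, _, dist_nonneg,
      ρ.2.mem_seg_iff h2 ((mem_seg_or_mem_seg hp _).resolve_right h1)⟩

theorem inl_mem_lineSeg_iff {p x y : T} {ξ η : GromovBoundary T}
    (hx : SameDir p (Sum.inr ξ) x) (hy : SameDir p (Sum.inr η) y) :
    Sum.inl p ∈ lineSeg ξ η ↔ p ∈ seg x y := by
  have hdef : Sum.inl p ∈ lineSeg ξ η ↔ ∃ r r' : Ray T, Quotient.mk (rayEnd T) r = ξ ∧
      Quotient.mk (rayEnd T) r' = η ∧ r.1 0 = p ∧ r'.1 0 = p ∧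
      ∀ s t : ℝ, 0 ≤ s → 0 ≤ t → dist (r.1 s) (r'.1 t) = s + t := inl_mem_pair_union_iff
  rw [hdef]
  have hray : ∀ (r : Ray T) (s : ℝ), 0 ≤ s → dist (r.1 0) (r.1 s) = s := fun r s hs => by
    rw [r.2 0 s le_rfl hs, zero_sub, abs_neg, abs_of_nonneg hs]
  constructor
  · rintro ⟨r, r', rfl, rfl, rfl, h0, h⟩
    obtain ⟨t, ⟨h1, h2⟩, h3⟩ := ((hx.eventually.and hy.eventually).and
      (eventually_ge_atTop 0)).exists
    rw [← mem_seg_congr h1 h2, mem_seg, h t t h3 h3, dist_comm, hray r t h3, ← h0, hray r' t h3]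
  · intro hp
    obtain ⟨r, rfl⟩ := Quotient.exists_rep ξ
    obtain ⟨r', rfl⟩ := Quotient.exists_rep η
    obtain ⟨ρ, h0, hρ⟩ := exists_ray_from p r
    obtain ⟨ρ', h0', hρ'⟩ := exists_ray_from p r'
    rw [← hρ] at hx ⊢
    rw [← hρ'] at hy ⊢
    refine ⟨ρ, ρ', rfl, rfl, h0, h0', fun s t hs ht => ?_⟩
    obtain ⟨u, ⟨h1, h2⟩, h3, h4⟩ := ((hx.eventually.and hy.eventually).and
      ((eventually_ge_atTop s).and (eventually_ge_atTop t))).exists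
    have h5 := (mem_seg_congr h1 h2).2 hp
    have k1 := hray ρ s hs
    have k2 := hray ρ u (hs.trans h3)
    have k3 := hray ρ' t ht
    have k4 := hray ρ' u (hs.trans h3)
    have k5 := ρ.2.mem_seg le_rfl hs h3
    have k6 := ρ'.2.mem_seg le_rfl ht h4
    rw [mem_seg, dist_comm] at h5
    rw [mem_seg] at k5 k6
    rw [h0] at k1 k2 k5
    rw [h0'] at k3 k4 k6
    apply le_antisymm
    · linarith [dist_triangle (ρ.1 s) p (ρ'.1 t), dist_comm p (ρ.1 s)]
    · linarith [dist_triangle4 (ρ.1 u) (ρ.1 s) (ρ'.1 t) (ρ'.1 u), dist_comm (ρ.1 s) (ρ.1 u)]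

theorem inl_mem_segHat_iff {p x y : T} {a b : TreeHat T} (hx : SameDir p a x)
    (hy : SameDir p b y) : Sum.inl p ∈ segHat a b ↔ p ∈ seg x y := by
  have hne : ∀ {a x : T}, SameDir p (Sum.inl a) x → p ≠ a := by
    rintro a x h rfl
    exact h.ne rfl
  rcases a with a | ξ <;> rcases b with b | η
  · have : (Sum.inl p : TreeHat T) ∈ segHat (Sum.inl a) (Sum.inl b) ↔ p ∈ seg a b :=
      Sum.inl_injective.mem_set_image
    exact this.trans (mem_seg_congr hx hy)
  · refine (inl_mem_raySeg_iff (hne hx) hy).trans ?_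
    exact mem_seg_congr hx (hy.notMem_seg hy)
  · refine (inl_mem_raySeg_iff (hne hy) hx).trans ?_
    rw [seg_comm x y]
    exact mem_seg_congr hy (hx.notMem_seg hx)
  · exact inl_mem_lineSeg_iff hx hy

theorem exists_sameDir_separating {a b : TreeHat T} (hab : a ≠ b) :
    ∃ p x y : T, SameDir p a x ∧ SameDir p b y ∧ p ∈ seg x y := by
  have key : ∀ (a : T) (ξ : GromovBoundary T),
      ∃ p x y : T, SameDir p (Sum.inl a) x ∧ SameDir p (Sum.inr ξ) y ∧ p ∈ seg x y := by
    intro a ξ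
    obtain ⟨r, rfl⟩ := Quotient.exists_rep ξ
    obtain ⟨ρ, rfl, hρ⟩ := exists_ray_from a r
    rw [← hρ]
    have hd : dist (ρ.1 1) (ρ.1 0) = 1 := by rw [ρ.2 1 0 (by norm_num) le_rfl]; norm_num
    refine ⟨ρ.1 1, ρ.1 0, ρ.1 2, ?_, ⟨ρ, rfl, ?_⟩,
      ρ.2.mem_seg le_rfl (by norm_num) (by norm_num)⟩
    · rw [sameDir_inl, mem_seg_self]
      intro h
      rw [h, dist_self] at hd
      norm_num at hd
    · filter_upwards [eventually_gt_atTop 1] with t ht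
      exact ρ.2.notMem_seg (by rwa [hd]) (by rw [hd]; norm_num)
  rcases a with a | ξ <;> rcases b with b | η
  · have hne : a ≠ b := fun h => hab (by rw [h])
    have hpos := dist_pos.2 hne
    obtain ⟨p, hp, hd⟩ := exists_mem_seg_dist_eq a b (s := dist a b / 2) (by linarith) (by linarith)
    refine ⟨p, a, b, ?_, ?_, hp⟩ <;> rw [sameDir_inl, mem_seg_self] <;> rintro rfl
    · rw [dist_self] at hd
      linarith
    · linarith
  · exact key a η
  · obtain ⟨p, x, y, h1, h2, h3⟩ := key b ξ
    exact ⟨p, y, x, h2, h1, by rwa [seg_comm]⟩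
  · obtain ⟨r, rfl⟩ := Quotient.exists_rep ξ
    obtain ⟨r', rfl⟩ := Quotient.exists_rep η
    obtain ⟨ρ, h0, hρ⟩ := exists_ray_from (r.1 0) r'
    rw [← hρ] at hab ⊢
    obtain ⟨t, ht, hne⟩ : ∃ t, 0 ≤ t ∧ r.1 t ≠ ρ.1 t := by
      by_contra! hcon
      refine hab (congrArg Sum.inr (Quotient.sound ⟨0, fun t ht => ?_⟩))
      rw [hcon t ht, dist_self]
    have hd : dist (r.1 t) (r.1 0) = t := by
      rw [r.2 t 0 ht le_rfl, sub_zero, abs_of_nonneg ht]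
    refine ⟨r.1 t, r.1 (t + 1), r.1 0, ⟨r, rfl, ?_⟩, ⟨ρ, rfl, ?_⟩, ?_⟩
    · filter_upwards [eventually_gt_atTop t] with s hs
      exact r.2.notMem_seg (by rwa [hd]) (by rw [hd]; linarith)
    · filter_upwards [eventually_ge_atTop 0] with s hs hmem
      rw [seg_comm, ← h0] at hmem
      have := ρ.2.mem_seg_iff hs hmem
      rw [h0, dist_comm, hd] at this
      exact hne this.symm
    · rw [seg_comm]
      exact r.2.mem_seg le_rfl ht (by linarith)

theorem tendsto_observers_iff {α : Type*} {l : Filter α} {u : α → TreeHat T} {a : TreeHat T} :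
    Tendsto u l (@nhds _ (observersTopology T) a) ↔
      ∀ p x, SameDir p a x → ∀ᶠ n in l, SameDir p (u n) x := by
  rw [observersTopology, TopologicalSpace.tendsto_nhds_generateFrom_iff]
  constructor
  · intro h p x hx
    have hxx : SameDir p (Sum.inl x) x := hx.notMem_seg hx
    filter_upwards [h _ ⟨Sum.inl p, Sum.inl x, hxx.ne, rfl⟩
      ⟨hx.ne, mt (inl_mem_segHat_iff hxx hx).1 hxx⟩] with n hn
    obtain ⟨z, hz⟩ := exists_sameDir hn.1
    refine hz.trans ?_
    rw [seg_comm]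
    exact mt (inl_mem_segHat_iff hxx hz).2 hn.2
  · rintro h s ⟨P, x, hxP, rfl⟩ ⟨haP, hmem⟩
    rcases P with p | ξ
    · obtain ⟨y, hy⟩ := exists_sameDir hxP
      obtain ⟨z, hz⟩ := exists_sameDir haP
      have hyz : p ∉ seg y z := mt (inl_mem_segHat_iff hy hz).2 hmem
      rw [seg_comm] at hyz
      filter_upwards [h p y (hz.trans hyz)] with n hn
      refine ⟨hn.ne, fun hp => (hn.notMem_seg hn) ?_⟩
      exact (inl_mem_segHat_iff hy hn).1 hp
    · obtain ⟨p, y, z, hy, hz, hp⟩ := exists_sameDir_separating haP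
      filter_upwards [h p y hy] with n hn
      have hne : u n ≠ Sum.inr ξ := fun h => by
        rw [h] at hn
        exact hn.notMem_seg hz hp
      refine ⟨hne, fun hmem => ?_⟩
      generalize u n = b at hne hmem
      rcases x with x | η <;> rcases b with b | ζ
      · obtain ⟨q, -, hq⟩ := hmem
        cases hq
      · exact hne (congrArg Sum.inr (inr_mem_singleton_union_iff.1 hmem).symm)
      · exact hxP (congrArg Sum.inr (inr_mem_singleton_union_iff.1 hmem).symm)
      · rcases inr_mem_pair_union_iff.1 hmem with rfl | rfl
        · exact hxP rfl
        · exact hne rfl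

end Directions

section Words

variable {ι : Type*}

theorem InfWord.isReduced_ofFn (X : InfWord ι) (n : ℕ) :
    FreeGroup.IsReduced (List.ofFn fun i : Fin n => X.letter i) := by
  rw [FreeGroup.IsReduced, List.isChain_ofFn]
  intro i hi h1
  by_contra h2
  exact X.reduced i ⟨h1, Bool.eq_not_of_ne h2⟩

theorem InfWord.prefixN_add (X : InfWord ι) (k n : ℕ) :
    X.prefixN (k + n) = X.prefixN k * (X.shift k).prefixN n := by
  rw [InfWord.prefixN, InfWord.prefixN, InfWord.prefixN, FreeGroup.mul_mk, List.ofFn_add]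
  rfl

theorem InfWord.ofFn_succ (X : InfWord ι) (n : ℕ) :
    (List.ofFn fun i : Fin (n + 1) => X.letter i) =
      (List.ofFn fun i : Fin n => X.letter i) ++ [X.letter n] := by
  rw [List.ofFn_succ_last]
  rfl

theorem isReduced_invRev_append {l l' : List (ι × Bool)} (h : FreeGroup.IsReduced l)
    (h' : FreeGroup.IsReduced l') (hne : l.head? ≠ l'.head?) :
    FreeGroup.IsReduced (FreeGroup.invRev l ++ l') := by
  classical
  refine List.isChain_append.2 ⟨?_, h', ?_⟩
  · have := FreeGroup.isReduced_toWord (x := (FreeGroup.mk l)⁻¹)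
    rwa [FreeGroup.toWord_inv, FreeGroup.toWord_mk, h.reduce_eq] at this
  · intro a ha b hb h1
    rw [FreeGroup.invRev, List.getLast?_reverse, List.head?_map] at ha
    obtain ⟨c, hc, rfl⟩ := Option.mem_map.1 ha
    by_contra h2
    refine hne (Eq.trans hc (Eq.trans (congrArg some (Prod.ext h1 ?_)) hb.symm))
    revert h2
    cases c.2 <;> cases b.2 <;> simp

variable [DecidableEq ι]

theorem InfWord.toWord_prefixN (X : InfWord ι) (n : ℕ) :
    (X.prefixN n).toWord = List.ofFn fun i : Fin n => X.letter i := by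
  rw [InfWord.prefixN, FreeGroup.toWord_mk, (X.isReduced_ofFn n).reduce_eq]

/-- The reduced word of `g` and the infinite word `X` have the same prefix of length `n`. -/
def HasPrefix (g : FreeGroup ι) (X : InfWord ι) (n : ℕ) : Prop :=
  g.toWord.take n = List.ofFn fun i : Fin n => X.letter i

theorem HasPrefix.le_length {g : FreeGroup ι} {X : InfWord ι} {n : ℕ} (h : HasPrefix g X n) :
    n ≤ g.toWord.length := by
  have := congrArg List.length h
  simpa using this

theorem HasPrefix.mono {g : FreeGroup ι} {X : InfWord ι} {m n : ℕ} (h : HasPrefix g X n)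
    (hmn : m ≤ n) : HasPrefix g X m := by
  obtain ⟨k, rfl⟩ := Nat.exists_eq_add_of_le hmn
  have h1 := congrArg (List.take m) h
  rw [List.take_take, min_eq_left hmn, List.ofFn_add, List.take_left' (by simp)] at h1
  exact h1

theorem hasPrefix_prefixN (X : InfWord ι) {m n : ℕ} (h : m ≤ n) :
    HasPrefix (X.prefixN n) X m := by
  refine HasPrefix.mono (n := n) ?_ h
  rw [HasPrefix, X.toWord_prefixN, List.take_of_length_le (by simp)]

theorem HasPrefix.mul_letter {g : FreeGroup ι} {X : InfWord ι} {n : ℕ}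
    (h : HasPrefix g X (n + 1)) (a : ι × Bool) : HasPrefix (g * FreeGroup.mk [a]) X n := by
  have hlen := h.le_length
  have hn := h.mono n.le_succ
  rcases List.eq_nil_or_concat g.toWord with hl | ⟨l, b, hl⟩
  · simp [hl] at hlen
  rw [List.concat_eq_append] at hl
  have hg : g = FreeGroup.mk (l ++ [b]) := by rw [← hl, FreeGroup.mk_toWord]
  have hred : FreeGroup.IsReduced (l ++ [b]) := hl ▸ FreeGroup.isReduced_toWord
  rw [hl] at hlen
  rw [HasPrefix, hl] at hn
  have hnl : n ≤ l.length := by simpa using hlen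
  by_cases hab : b.1 = a.1 → b.2 = a.2
  · have hred' : FreeGroup.IsReduced (l ++ [b] ++ [a]) :=
      List.isChain_append.2 ⟨hred, List.isChain_singleton _, by simpa using hab⟩
    rw [HasPrefix, hg, FreeGroup.mul_mk, FreeGroup.toWord_mk, hred'.reduce_eq,
      List.take_append_of_le_length (by simpa using hnl.trans (Nat.le_succ _))]
    exact hn
  · rw [Classical.not_imp] at hab
    have hb : b = (a.1, !a.2) := Prod.ext hab.1 (Bool.eq_not_of_ne hab.2)
    have hmul : g * FreeGroup.mk [a] = FreeGroup.mk l := by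
      rw [hg, FreeGroup.mul_mk, List.append_assoc, ← FreeGroup.mul_mk, hb]
      have : (FreeGroup.mk ([(a.1, !a.2)] ++ [a]) : FreeGroup ι) = 1 :=
        Quot.sound FreeGroup.Red.Step.cons_not_rev
      rw [this, mul_one]
    have hred' : FreeGroup.IsReduced l := List.IsChain.left_of_append hred
    rw [HasPrefix, hmul, FreeGroup.toWord_mk, hred'.reduce_eq, ← hn,
      List.take_append_of_le_length hnl]

theorem HasPrefix.mul {g : FreeGroup ι} {X : InfWord ι} {n : ℕ} (u : FreeGroup ι)
    (h : HasPrefix g X (n + u.toWord.length)) : HasPrefix (g * u) X n := by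
  have key : ∀ (l : List (ι × Bool)) (g : FreeGroup ι), HasPrefix g X (n + l.length) →
      HasPrefix (g * FreeGroup.mk l) X n := by
    intro l
    induction l with
    | nil => intro g h; simpa [← FreeGroup.one_eq_mk] using h
    | cons a l ih =>
      intro g h
      rw [← List.singleton_append, ← FreeGroup.mul_mk, ← mul_assoc]
      exact ih _ (HasPrefix.mul_letter h a)
  have := key u.toWord g h
  rwa [FreeGroup.mk_toWord] at this

theorem HasPrefix.head? {g : FreeGroup ι} {X : InfWord ι} {n : ℕ} (h : HasPrefix g X (n + 1)) :
    ((X.prefixN n)⁻¹ * g).toWord.head? = some (X.letter n) := by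
  have h1 : g.toWord = (List.ofFn fun i : Fin n => X.letter i) ++
      (X.letter n :: g.toWord.drop (n + 1)) := by
    conv_lhs => rw [← List.take_append_drop (n + 1) g.toWord]
    rw [h, X.ofFn_succ, List.append_assoc, List.singleton_append]
  have hred : FreeGroup.IsReduced (X.letter n :: g.toWord.drop (n + 1)) :=
    List.IsChain.right_of_append (h1 ▸ FreeGroup.isReduced_toWord)
  have h2 : (X.prefixN n)⁻¹ * g = FreeGroup.mk (X.letter n :: g.toWord.drop (n + 1)) := by
    rw [inv_mul_eq_iff_eq_mul, InfWord.prefixN, FreeGroup.mul_mk, ← h1, FreeGroup.mk_toWord]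
  rw [h2, FreeGroup.toWord_mk, hred.reduce_eq, List.head?_cons]

theorem lt_length_of_head? {h : FreeGroup ι} {X : InfWord ι} {n : ℕ}
    (hh : ((X.prefixN n)⁻¹ * h).toWord.head? = some (X.letter n)) : n < h.toWord.length := by
  obtain ⟨l, hl⟩ := List.head?_eq_some_iff.1 hh
  have hred : FreeGroup.IsReduced ([X.letter n] ++ l) := by
    rw [List.singleton_append, ← hl]
    exact FreeGroup.isReduced_toWord
  have hred' := (X.ofFn_succ n ▸ X.isReduced_ofFn (n + 1)).append_overlap hred (by simp)
  have h2 : h = FreeGroup.mk ((List.ofFn fun i : Fin n => X.letter i) ++ [X.letter n] ++ l) := by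
    rw [List.append_assoc, ← FreeGroup.mul_mk, List.singleton_append, ← hl, FreeGroup.mk_toWord]
    exact (mul_inv_cancel_left _ _).symm
  rw [h2, FreeGroup.toWord_mk, hred'.reduce_eq]
  simp

/-- If `h` is shorter than `n`, and `g` starts with the prefix of length `n + 1` of `X`, then
the prefix of length `n` of `X` separates `g` from `h` in the Cayley tree. -/
theorem HasPrefix.head?_ne {g h : FreeGroup ι} {X : InfWord ι} {n : ℕ}
    (hg : HasPrefix g X (n + 1)) (hh : h.toWord.length ≤ n) :
    ((X.prefixN n)⁻¹ * h).toWord.head? ≠ ((X.prefixN n)⁻¹ * g).toWord.head? := by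
  rw [hg.head?]
  exact fun h' => (lt_length_of_head? h').not_ge hh

end Words

namespace SystemOfIsometries

variable {K : Type*} [MetricSpace K] {ι : Type*} (S : SystemOfIsometries K ι)

/-- The partial isometry associated to a list of letters. -/
def listPE (l : List (ι × Bool)) : PartialEquiv K K :=
  (l.map S.letterPE).foldl PartialEquiv.trans (PartialEquiv.refl K)

theorem listPE_cons (a : ι × Bool) (l : List (ι × Bool)) :
    S.listPE (a :: l) = (S.letterPE a).trans (S.listPE l) := by
  have key : ∀ (L : List (PartialEquiv K K)) (e : PartialEquiv K K),
      L.foldl PartialEquiv.trans e =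
        e.trans (L.foldl PartialEquiv.trans (PartialEquiv.refl K)) := by
    intro L
    induction L with
    | nil => intro e; simp
    | cons f L ih =>
      intro e
      rw [List.foldl_cons, List.foldl_cons, ih, ih ((PartialEquiv.refl K).trans f),
        PartialEquiv.refl_trans, PartialEquiv.trans_assoc]
  rw [listPE, List.map_cons, List.foldl_cons, key, PartialEquiv.refl_trans]
  rfl

theorem listPE_source_append (l l' : List (ι × Bool)) :
    (S.listPE (l ++ l')).source ⊆ (S.listPE l).source := by
  induction l with
  | nil => simp [listPE]
  | cons a l ih =>
    rw [List.cons_append, listPE_cons, listPE_cons, PartialEquiv.trans_source,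
      PartialEquiv.trans_source]
    exact inter_subset_inter_right _ (preimage_mono ih)

theorem letterPE_not (a : ι × Bool) : S.letterPE (a.1, !a.2) = (S.letterPE a).symm := by
  rcases a with ⟨i, _ | _⟩ <;> rfl

theorem letterPE_dist (a : ι × Bool) {x y : K} (hx : x ∈ (S.letterPE a).source)
    (hy : y ∈ (S.letterPE a).source) :
    dist (S.letterPE a x) (S.letterPE a y) = dist x y := by
  rcases a with ⟨i, _ | _⟩
  · have h := S.isom i _ ((S.pe i).map_target hx) _ ((S.pe i).map_target hy)
    rw [(S.pe i).right_inv hx, (S.pe i).right_inv hy] at h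
    exact h.symm
  · exact S.isom i x hx y hy

theorem letterPE_source_subtree (a : ι × Bool) : IsClosedSubtree (S.letterPE a).source := by
  rcases a with ⟨i, _ | _⟩
  · exact S.target_subtree i
  · exact S.source_subtree i

variable [CompactSpace K] [IsRTree K]

theorem exists_letter_proj (a : ι × Bool) (x : K) :
    ∃ c ∈ (S.letterPE a).source, ∀ z ∈ (S.letterPE a).source, c ∈ seg x z :=
  (S.letterPE_source_subtree a).2.2.exists_proj (S.letterPE_source_subtree a).2.1.isCompact
    (S.letterPE_source_subtree a).1 x

/-- The extension of the partial isometry of a letter to all of `K`, by precomposition with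
the projection onto its domain. -/
def letterExt (a : ι × Bool) (x : K) : K := S.letterPE a (S.exists_letter_proj a x).choose

theorem letterExt_of_mem {a : ι × Bool} {x : K} (hx : x ∈ (S.letterPE a).source) :
    S.letterExt a x = S.letterPE a x := by
  have h := (S.exists_letter_proj a x).choose_spec.2 x hx
  rw [mem_seg_self] at h
  rw [letterExt, h]

theorem letterExt_mem (a : ι × Bool) (x : K) : S.letterExt a x ∈ (S.letterPE a).target :=
  (S.letterPE a).map_source (S.exists_letter_proj a x).choose_spec.1

theorem dist_letterExt_le (a : ι × Bool) (x y : K) :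
    dist (S.letterExt a x) (S.letterExt a y) ≤ dist x y := by
  have hx := (S.exists_letter_proj a x).choose_spec
  have hy := (S.exists_letter_proj a y).choose_spec
  rw [letterExt, letterExt, S.letterPE_dist a hx.1 hy.1]
  exact dist_proj_le hx.1 hy.1 hx.2 hy.2

/-- The composition of the extended partial isometries along a list of letters. -/
def listExt (l : List (ι × Bool)) (x : K) : K := l.foldl (fun x a => S.letterExt a x) x

theorem dist_listExt_le (l : List (ι × Bool)) (x y : K) :
    dist (S.listExt l x) (S.listExt l y) ≤ dist x y := by
  induction l generalizing x y with
  | nil => rfl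
  | cons a l ih => exact (ih _ _).trans (S.dist_letterExt_le a x y)

variable [DecidableEq ι]

theorem listExt_letter_mul {a : ι × Bool} {x : K} (hx : x ∈ (S.letterPE a).source)
    (g : FreeGroup ι) :
    S.listExt (FreeGroup.mk [a] * g).toWord x = S.listExt g.toWord (S.letterPE a x) := by
  have hg : g = FreeGroup.mk g.toWord := FreeGroup.mk_toWord.symm
  have hred : FreeGroup.IsReduced g.toWord := FreeGroup.isReduced_toWord
  generalize g.toWord = l at hg hred
  subst hg
  rw [FreeGroup.mul_mk, List.singleton_append, FreeGroup.toWord_mk]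
  by_cases h : FreeGroup.IsReduced (a :: l)
  · rw [h.reduce_eq, listExt, List.foldl_cons, S.letterExt_of_mem hx]
    rfl
  · rcases l with _ | ⟨b, l⟩
    · exact absurd FreeGroup.IsReduced.singleton h
    rw [FreeGroup.isReduced_cons_cons, not_and] at h
    have hab : ¬ (a.1 = b.1 → a.2 = b.2) := fun h' => h h' hred
    rw [Classical.not_imp] at hab
    have hb : b = (a.1, !a.2) := by
      refine Prod.ext hab.1.symm (Bool.eq_not_of_ne (Ne.symm hab.2))
    have hred' : FreeGroup.IsReduced l := List.IsChain.right_of_append (l₁ := [b]) hred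
    have hlen : FreeGroup.mk (a :: b :: l) = FreeGroup.mk l := by
      rw [hb]
      exact Quot.sound (FreeGroup.Red.Step.cons_not)
    rw [← FreeGroup.toWord_mk, hlen, FreeGroup.toWord_mk, hred'.reduce_eq]
    show _ = S.listExt l (S.letterExt b (S.letterPE a x))
    have hmem : S.letterPE a x ∈ (S.letterPE b).source := by
      rw [hb, letterPE_not]
      exact (S.letterPE a).map_source hx
    rw [S.letterExt_of_mem hmem, hb, letterPE_not, (S.letterPE a).left_inv hx]

end SystemOfIsometries

namespace AssocTree

open scoped BoundedContinuousFunction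

variable {K : Type} [MetricSpace K] {ι : Type} [DecidableEq ι]
  {S : SystemOfIsometries K ι} (A : AssocTree S)

theorem letter_compat {a : ι × Bool} {x : K} (hx : x ∈ (S.letterPE a).source) :
    (FreeGroup.mk [a])⁻¹ • A.emb x = A.emb (S.letterPE a x) := by
  rcases a with ⟨i, _ | _⟩
  · have h := A.compat i _ ((S.pe i).map_target hx)
    rw [(S.pe i).right_inv hx, inv_smul_eq_iff] at h
    rw [FreeGroup.inv_mk]
    exact h.symm
  · exact A.compat i x hx

variable [CompactSpace K] [IsRTree K]

theorem listExt_eq_of_smul {x y : K} {g : FreeGroup ι} (h : A.emb x = g • A.emb y) :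
    x = S.listExt g⁻¹.toWord y := by
  let : TopologicalSpace (FreeGroup ι) := ⊥
  have : DiscreteTopology (FreeGroup ι) := ⟨rfl⟩
  obtain ⟨C, hC⟩ := Metric.isBounded_iff.1 (isCompact_univ (X := K)).isBounded
  have hC' : ∀ x y : K, dist x y ≤ C := fun x y => hC (mem_univ x) (mem_univ y)
  let act : MulAction (FreeGroup ι) (FreeGroup ι →ᵇ K) :=
    { smul := fun h φ => BoundedContinuousFunction.mkOfDiscrete (fun g => φ (h⁻¹ * g)) C
        fun _ _ => hC' _ _
      one_smul := fun φ => by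
        ext g
        show φ (1⁻¹ * g) = φ g
        rw [inv_one, one_mul]
      mul_smul := fun h k φ => by
        ext g
        show φ ((h * k)⁻¹ * g) = φ (k⁻¹ * (h⁻¹ * g))
        rw [mul_inv_rev, mul_assoc] }
  have smul_apply : ∀ (h : FreeGroup ι) (φ : FreeGroup ι →ᵇ K) (g : FreeGroup ι),
      (h • φ) g = φ (h⁻¹ * g) := fun _ _ _ => rfl
  have hle : ∀ (h : FreeGroup ι) (φ ψ : FreeGroup ι →ᵇ K), dist (h • φ) (h • ψ) ≤ dist φ ψ :=
    fun h φ ψ => (BoundedContinuousFunction.dist_le dist_nonneg).2 fun g => by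
      rw [smul_apply, smul_apply]
      exact BoundedContinuousFunction.dist_coe_le_dist _
  let e' : K → (FreeGroup ι →ᵇ K) := fun x =>
    BoundedContinuousFunction.mkOfDiscrete (fun g => S.listExt g.toWord x) C fun _ _ => hC' _ _
  have e'_apply : ∀ x g, e' x g = S.listExt g.toWord x := fun _ _ => rfl
  have e'_one : ∀ x, e' x 1 = x := fun x => by
    rw [e'_apply, FreeGroup.toWord_one]
    rfl
  have he' : Isometry e' := Isometry.of_dist_eq fun x y => by
    refine le_antisymm ((BoundedContinuousFunction.dist_le dist_nonneg).2 fun g =>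
      S.dist_listExt_le _ _ _) ?_
    have := BoundedContinuousFunction.dist_coe_le_dist (f := e' x) (g := e' y) 1
    rwa [e'_one, e'_one] at this
  obtain ⟨f, ⟨-, hf, hfe⟩, -⟩ := A.universal (FreeGroup ι →ᵇ K)
    (fun h => Isometry.of_dist_eq fun φ ψ => le_antisymm (hle h φ ψ) (by
      have := hle h⁻¹ (h • φ) (h • ψ)
      rwa [inv_smul_smul, inv_smul_smul] at this)) e' he'
    (fun i x hx => by
      ext g
      rw [smul_apply, inv_inv, e'_apply, e'_apply]
      exact S.listExt_letter_mul (a := (i, true)) hx g)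
  have h1 := congrArg f h
  rw [hfe, hf, hfe] at h1
  have h2 := congrArg (fun φ : FreeGroup ι →ᵇ K => φ 1) h1
  simp only [smul_apply, mul_one, e'_one] at h2
  exact h2

theorem mem_source_of_smul {a : ι × Bool} {l : List (ι × Bool)}
    (hl : FreeGroup.IsReduced (a :: l)) {x y : K}
    (h : A.emb x = FreeGroup.mk (a :: l) • A.emb y) : x ∈ (S.letterPE a).source := by
  have h1 := A.listExt_eq_of_smul h
  rw [FreeGroup.toWord_inv, FreeGroup.toWord_mk, hl.reduce_eq, FreeGroup.invRev, List.map_cons,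
    List.reverse_cons, SystemOfIsometries.listExt, List.foldl_append, List.foldl_cons,
    List.foldl_nil] at h1
  have h2 := S.letterExt_mem (a.1, !a.2) (S.listExt (FreeGroup.invRev l) y)
  rw [S.letterPE_not] at h2
  rw [h1]
  exact h2

theorem mem_listPE_source {l : List (ι × Bool)} (hl : FreeGroup.IsReduced l) {x : K} :
    A.emb x ∈ FreeGroup.mk l • range A.emb ↔ x ∈ (S.listPE l).source := by
  induction l generalizing x with
  | nil => simp [SystemOfIsometries.listPE, ← FreeGroup.one_eq_mk]
  | cons a l ih =>
    have hl' : FreeGroup.IsReduced l := List.IsChain.right_of_append (l₁ := [a]) hl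
    rw [S.listPE_cons, PartialEquiv.trans_source, mem_inter_iff, mem_preimage, ← ih hl',
      ← List.singleton_append, ← FreeGroup.mul_mk]
    have key : ∀ hx : x ∈ (S.letterPE a).source,
        A.emb x ∈ (FreeGroup.mk [a] * FreeGroup.mk l) • range A.emb ↔
          A.emb (S.letterPE a x) ∈ FreeGroup.mk l • range A.emb := by
      intro hx
      rw [mul_smul, Set.mem_smul_set_iff_inv_smul_mem, A.letter_compat hx]
    refine ⟨fun h => ?_, fun h => (key h.1).2 h.2⟩
    have hx : x ∈ (S.letterPE a).source := by
      obtain ⟨_, ⟨y, rfl⟩, h'⟩ := h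
      exact A.mem_source_of_smul (y := y) hl h'.symm
    exact ⟨hx, (key hx).1 h⟩

theorem mem_dom {g : FreeGroup ι} {x : K} : x ∈ S.dom g ↔ A.emb x ∈ g • range A.emb := by
  conv_rhs => rw [← FreeGroup.mk_toWord (x := g)]
  exact (A.mem_listPE_source FreeGroup.isReduced_toWord).symm

theorem mem_smul_of_append {l l' : List (ι × Bool)} (hl : FreeGroup.IsReduced (l ++ l')) {x : K}
    (h : A.emb x ∈ FreeGroup.mk (l ++ l') • range A.emb) :
    A.emb x ∈ FreeGroup.mk l • range A.emb := by
  rw [A.mem_listPE_source (List.IsChain.left_of_append hl)]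
  exact S.listPE_source_append l l' ((A.mem_listPE_source hl).1 h)

end AssocTree

namespace AssocTree

attribute [instance] AssocTree.tree

variable {K : Type} [MetricSpace K] {ι : Type} [DecidableEq ι]
  {S : SystemOfIsometries K ι} (A : AssocTree S)

/-- The translate of `K` by `g` in the associated tree. -/
def tile (g : FreeGroup ι) : Set A.carrier := g • range A.emb

theorem tile_one : A.tile 1 = range A.emb := one_smul _ _

theorem mem_tile_iff {g : FreeGroup ι} {p : A.carrier} :
    p ∈ A.tile g ↔ ∃ k : K, g • A.emb k = p := by
  rw [tile, Set.mem_smul_set]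
  simp

theorem smul_emb_mem_tile (g : FreeGroup ι) (k : K) : g • A.emb k ∈ A.tile g :=
  A.mem_tile_iff.2 ⟨k, rfl⟩

theorem smul_mem_tile_iff {g h : FreeGroup ι} {p : A.carrier} :
    h • p ∈ A.tile g ↔ p ∈ A.tile (h⁻¹ * g) := by
  rw [tile, tile, mul_smul, Set.mem_inv_smul_set_iff]

theorem smul_mem_seg_iff (g : FreeGroup ι) {p x y : A.carrier} :
    g • p ∈ seg (g • x) (g • y) ↔ p ∈ seg x y :=
  mem_seg_map_iff (A.act_isom g)

theorem isSubtree_tile (g : FreeGroup ι) : IsSubtree (A.tile g) := by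
  intro x hx y hy z hz
  obtain ⟨k, rfl⟩ := A.mem_tile_iff.1 hx
  obtain ⟨m, rfl⟩ := A.mem_tile_iff.1 hy
  have h : g⁻¹ • z ∈ seg (A.emb k) (A.emb m) := by
    rwa [← A.smul_mem_seg_iff g, smul_inv_smul]
  rw [← smul_inv_smul g z, smul_mem_tile_iff, inv_mul_cancel, tile, one_smul]
  exact A.emb_subtree _ (mem_range_self _) _ (mem_range_self _) h

theorem isBridge_of_proj {g : FreeGroup ι} {x₀ a q : A.carrier} (hx₀ : x₀ ∈ A.tile 1)
    (hq : q ∈ A.tile g) (hproj : ∀ z ∈ A.tile g, q ∈ seg x₀ z) (ha : a ∈ A.tile 1)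
    (haproj : ∀ z ∈ A.tile 1, a ∈ seg q z) :
    IsBridge (range A.emb) (g • range A.emb) a q := by
  show IsBridge _ (A.tile g) a q
  rw [← tile_one]
  refine ⟨ha, hq, Subset.antisymm ?_ ?_, Subset.antisymm ?_ ?_⟩
  · rintro z ⟨hz, hz1⟩
    have h := haproj z hz1
    rw [mem_seg] at h hz
    rw [dist_comm q a] at h
    rw [dist_comm q z] at h
    exact dist_eq_zero.1 (by linarith [dist_comm z a])
  · rintro z rfl
    exact ⟨left_mem_seg _ _, ha⟩
  · rintro z ⟨hz, hzg⟩
    have h := hproj z hzg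
    have h' := haproj x₀ hx₀
    rw [mem_seg] at h h' hz
    have := dist_triangle x₀ a z
    exact dist_eq_zero.1 (by
      linarith [dist_comm q z, dist_comm q x₀, dist_comm q a, dist_comm a x₀,
        dist_nonneg (x := z) (y := q)])
  · rintro z rfl
    exact ⟨right_mem_seg _ _, hq⟩

variable [CompactSpace K]

theorem isCompact_tile (g : FreeGroup ι) : IsCompact (A.tile g) := by
  rw [tile, ← Set.image_smul]
  exact (isCompact_range A.emb_isom.continuous).image (A.act_isom g).continuous

variable [IsRTree K]

theorem mem_tile_one_of_head?_ne {g h : FreeGroup ι} (hne : g.toWord.head? ≠ h.toWord.head?)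
    {p : A.carrier} (hg : p ∈ A.tile g) (hh : p ∈ A.tile h) : p ∈ A.tile 1 := by
  obtain ⟨x, rfl⟩ := A.mem_tile_iff.1 hg
  have hred := isReduced_invRev_append FreeGroup.isReduced_toWord FreeGroup.isReduced_toWord hne
  have hinv : FreeGroup.mk (FreeGroup.invRev g.toWord) = g⁻¹ := by
    rw [← FreeGroup.inv_mk, FreeGroup.mk_toWord]
  rw [smul_mem_tile_iff] at hh ⊢
  rw [mul_one, ← hinv]
  refine A.mem_smul_of_append hred ?_
  rw [← FreeGroup.mul_mk, hinv, FreeGroup.mk_toWord]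
  exact hh

/-- Two tiles whose indices lie on different sides of `u` in the Cayley tree meet inside the
tile of `u`. -/
theorem mem_tile_of_head?_ne {u g h : FreeGroup ι}
    (hne : (u⁻¹ * g).toWord.head? ≠ (u⁻¹ * h).toWord.head?)
    {p : A.carrier} (hg : p ∈ A.tile g) (hh : p ∈ A.tile h) : p ∈ A.tile u := by
  have h1 := A.mem_tile_one_of_head?_ne hne (p := u⁻¹ • p)
    (by rwa [smul_mem_tile_iff, inv_inv, mul_inv_cancel_left])
    (by rwa [smul_mem_tile_iff, inv_inv, mul_inv_cancel_left])
  rwa [smul_mem_tile_iff, inv_inv, mul_one] at h1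

/-- A segment joining two tiles whose indices lie on different sides of `u` in the Cayley tree
meets the tile of `u`. -/
theorem exists_mem_seg_tile {u g h : FreeGroup ι}
    (hne : (u⁻¹ * g).toWord.head? ≠ (u⁻¹ * h).toWord.head?)
    {p q : A.carrier} (hp : p ∈ A.tile g) (hq : q ∈ A.tile h) :
    ∃ z ∈ seg p q, z ∈ A.tile u := by
  obtain ⟨F, hF⟩ := A.seg_cover p q
  set P : FreeGroup ι → Prop := fun v => (u⁻¹ * v).toWord.head? = (u⁻¹ * h).toWord.head?
  set C₁ : Set A.carrier := ⋃ v ∈ (insert h F).filter P, A.tile v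
  set C₂ : Set A.carrier := ⋃ v ∈ (insert g F).filter (fun v => ¬ P v), A.tile v
  have hC₁ : IsClosed C₁ :=
    ((insert h F).filter P).isCompact_biUnion (fun v _ => A.isCompact_tile v) |>.isClosed
  have hC₂ : IsClosed C₂ := ((insert g F).filter (fun v => ¬ P v)).isCompact_biUnion
    (fun v _ => A.isCompact_tile v) |>.isClosed
  have hcov : seg p q ⊆ C₁ ∪ C₂ := by
    intro z hz
    obtain ⟨v, hv, hzv⟩ := mem_iUnion₂.1 (hF hz)
    by_cases hP : P v
    · exact Or.inl (mem_iUnion₂.2 ⟨v, by simp [hv, hP], hzv⟩)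
    · exact Or.inr (mem_iUnion₂.2 ⟨v, by simp [hv, hP], hzv⟩)
  obtain ⟨z, hz, hz₁, hz₂⟩ := isPreconnected_closed_iff.1 (isPreconnected_seg p q) C₁ C₂ hC₁ hC₂
    hcov ⟨q, right_mem_seg p q, mem_iUnion₂.2 ⟨h, by simp [P], hq⟩⟩
    ⟨p, left_mem_seg p q, mem_iUnion₂.2 ⟨g, by simp [P, hne], hp⟩⟩
  obtain ⟨v, hv, hzv⟩ := mem_iUnion₂.1 hz₁
  obtain ⟨w, hw, hzw⟩ := mem_iUnion₂.1 hz₂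
  refine ⟨z, hz, A.mem_tile_of_head?_ne (fun h' => (Finset.mem_filter.1 hw).2 ?_) hzv hzw⟩
  exact h'.symm.trans (Finset.mem_filter.1 hv).2

theorem exists_mem_seg_tile_prefixN {X : InfWord ι} {n : ℕ} {g h : FreeGroup ι}
    (hg : HasPrefix g X (n + 1)) (hh : h.toWord.length ≤ n) {p q : A.carrier}
    (hp : p ∈ A.tile h) (hq : q ∈ A.tile g) : ∃ z ∈ seg p q, z ∈ A.tile (X.prefixN n) :=
  A.exists_mem_seg_tile (hg.head?_ne hh) hp hq

theorem mem_tile_prefixN {X : InfWord ι} {n : ℕ} {g h : FreeGroup ι}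
    (hg : HasPrefix g X (n + 1)) (hh : h.toWord.length ≤ n) {p : A.carrier}
    (hp : p ∈ A.tile h) (hq : p ∈ A.tile g) : p ∈ A.tile (X.prefixN n) :=
  A.mem_tile_of_head?_ne (hg.head?_ne hh) hp hq

theorem mem_domInf_shift {X : InfWord ι} {k : ℕ} {x : K} :
    x ∈ S.domInf (X.shift k) ↔ ∀ n, X.prefixN k • A.emb x ∈ A.tile (X.prefixN (k + n)) := by
  rw [SystemOfIsometries.domInf, mem_iInter]
  refine forall_congr' fun n => ?_
  rw [A.mem_dom, smul_mem_tile_iff, X.prefixN_add, inv_mul_cancel_left]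
  rfl
theorem eq_of_mem_tile_prefixN (hind : S.IndependentGenerators) {X : InfWord ι} {k : ℕ}
    {p q : A.carrier} (hp : ∀ n, k ≤ n → p ∈ A.tile (X.prefixN n))
    (hq : ∀ n, k ≤ n → q ∈ A.tile (X.prefixN n)) : p = q := by
  obtain ⟨x, rfl⟩ := A.mem_tile_iff.1 (hp k le_rfl)
  obtain ⟨y, rfl⟩ := A.mem_tile_iff.1 (hq k le_rfl)
  have hx : x ∈ S.domInf (X.shift k) := A.mem_domInf_shift.2 fun n => hp _ (Nat.le_add_right k n)
  have hy : y ∈ S.domInf (X.shift k) := A.mem_domInf_shift.2 fun n => hq _ (Nat.le_add_right k n)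
  obtain ⟨z, hz⟩ := hind (X.shift k) fun n => ⟨x, mem_iInter.1 hx n⟩
  rw [hz, mem_singleton_iff] at hx hy
  rw [hx, hy]

theorem exists_forall_notMem_seg_of_mem_tile (hind : S.IndependentGenerators) {X : InfWord ι}
    {k : ℕ} {p q : A.carrier} (hq : ∀ n, k ≤ n → q ∈ A.tile (X.prefixN n)) (hpq : p ≠ q) :
    ∃ i, ∀ g, HasPrefix g X i → ∀ y ∈ A.tile g, p ∉ seg q y := by
  obtain ⟨h, x, hx⟩ := A.orbit_meets p
  have hp : p ∈ A.tile h := A.mem_tile_iff.2 ⟨x, hx.symm⟩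
  obtain ⟨j, hj, hpj⟩ : ∃ j, max k h.toWord.length ≤ j ∧ p ∉ A.tile (X.prefixN j) := by
    by_contra! hcon
    exact hpq (A.eq_of_mem_tile_prefixN hind hcon
      fun n hn => hq n ((le_max_left _ _).trans hn))
  refine ⟨j + 1, fun g hg y hy hpy => hpj ?_⟩
  obtain ⟨z, hz, hzj⟩ := A.exists_mem_seg_tile_prefixN hg ((le_max_right _ _).trans hj) hp hy
  rw [seg_comm] at hz hpy
  have := mem_seg_right_of_mem hpy hz
  exact A.isSubtree_tile _ z hzj q (hq j ((le_max_left _ _).trans hj)) this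

theorem proj_mem_seg {X : InfWord ι} {n : ℕ} {x₀ q y : A.carrier} (hx₀ : x₀ ∈ A.tile 1)
    (hq : ∀ z ∈ A.tile (X.prefixN n), q ∈ seg x₀ z) {g : FreeGroup ι}
    (hg : HasPrefix g X (n + 1)) (hy : y ∈ A.tile g) : q ∈ seg x₀ y := by
  obtain ⟨z, hz, hzn⟩ := A.exists_mem_seg_tile_prefixN hg (by simp) hx₀ hy
  exact mem_seg_of_mem_seg_left hz (hq z hzn)

theorem eventuallyAdmissible_of_frequently {X : InfWord ι} {q : ℕ → A.carrier}
    (hq : ∀ n, q n ∈ A.tile (X.prefixN n)) {g : FreeGroup ι}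
    (hg : ∃ᶠ n in atTop, q n ∈ A.tile g) : S.EventuallyAdmissible X := by
  refine ⟨g.toWord.length, fun n => ?_⟩
  obtain ⟨j, hj, hjg⟩ := frequently_atTop.1 hg (g.toWord.length + n + 1)
  have key : ∀ m, g.toWord.length ≤ m → m + 1 ≤ j → q j ∈ A.tile (X.prefixN m) := fun m h1 h2 =>
    A.mem_tile_prefixN (hasPrefix_prefixN X h2) h1 hjg (hq j)
  obtain ⟨x, hx⟩ := A.mem_tile_iff.1 (key g.toWord.length le_rfl (by omega))
  have h := key (g.toWord.length + n) (by omega) (by omega)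
  rw [← hx, smul_mem_tile_iff, X.prefixN_add, inv_mul_cancel_left] at h
  exact ⟨x, A.mem_dom.2 h⟩

theorem exists_forall_notMem_seg_of_proj {X : InfWord ι} (hX : ¬ S.EventuallyAdmissible X)
    {x₀ : A.carrier} (hx₀ : x₀ ∈ A.tile 1) {q : ℕ → A.carrier}
    (hq : ∀ n, q n ∈ A.tile (X.prefixN n))
    (hproj : ∀ n, ∀ z ∈ A.tile (X.prefixN n), q n ∈ seg x₀ z) {p : A.carrier} {m : ℕ}
    (hp : ∀ n, m ≤ n → p ∉ seg (q m) (q n)) :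
    ∃ i, ∀ g, HasPrefix g X i → ∀ y ∈ A.tile g, p ∉ seg (q m) y := by
  by_contra! hcon
  have hmem : ∀ n, m ≤ n → q n ∈ seg (q m) p := by
    intro n hn
    obtain ⟨g, hg, y, hy, hpy⟩ := hcon (n + 1)
    have h1 := A.proj_mem_seg hx₀ (hproj n) hg hy
    have h2 : q m ∈ seg x₀ (q n) := by
      rcases hn.eq_or_lt with rfl | hn
      · exact right_mem_seg _ _
      · exact A.proj_mem_seg hx₀ (hproj m) (hasPrefix_prefixN X hn) (hq n)
    exact (seg_total hpy (mem_seg_right_of_mem h1 h2)).resolve_left (hp n hn)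
  obtain ⟨F, hF⟩ := A.seg_cover (q m) p
  have hfin : ∀ᶠ n in atTop, ∀ g ∈ F, q n ∉ A.tile g := by
    rw [eventually_all_finset]
    intro g _
    by_contra hg
    exact hX (A.eventuallyAdmissible_of_frequently hq hg)
  obtain ⟨n, hn, hmn⟩ := (hfin.and (eventually_ge_atTop m)).exists
  obtain ⟨g, hg, hng⟩ := mem_iUnion₂.1 (hF (hmem n hmn))
  exact hn g hg hng

end AssocTree

theorem eventually_letter_eq {ι : Type*} (X : InfWord ι) (i : ℕ) :
    ∀ᶠ Y in 𝓝 X, ∀ m < i, Y.letter m = X.letter m := by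
  let : TopologicalSpace (ι × Bool) := ⊥
  have : DiscreteTopology (ι × Bool) := ⟨rfl⟩
  refine (Set.finite_lt_nat i).eventually_all.2 fun m _ => ?_
  have hc : Continuous fun Y : InfWord ι => Y.letter m :=
    (continuous_apply m).comp continuous_induced_dom
  exact hc.continuousAt.eventually ((isOpen_discrete {X.letter m}).mem_nhds rfl)

theorem HasPrefix.congr {ι : Type*} [DecidableEq ι] {g : FreeGroup ι} {X Y : InfWord ι} {i : ℕ}
    (h : HasPrefix g Y i) (hXY : ∀ m < i, Y.letter m = X.letter m) : HasPrefix g X i :=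
  h.trans (congrArg List.ofFn (funext fun m => hXY m m.2))

theorem tendstoBoundary_prefixN {ι : Type*} [DecidableEq ι] (X : InfWord ι) :
    TendstoBoundary X.prefixN X := fun _ =>
  (eventually_ge_atTop _).mono fun _ h => hasPrefix_prefixN X h

theorem exists_mem_seg_of_isometry {T T' : Type*} [MetricSpace T] [MetricSpace T'] [IsRTree T]
    [IsRTree T'] {e : T → T'} (he : Isometry e) {x y : T} {p : T'} (hp : p ∈ seg (e x) (e y)) :
    ∃ z ∈ seg x y, e z = p := by
  have h1 : dist (e x) p ≤ dist x y := by
    rw [← he.dist_eq]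
    rw [mem_seg] at hp
    linarith [dist_nonneg (x := p) (y := e y)]
  obtain ⟨z, hz, hd⟩ := exists_mem_seg_dist_eq x y dist_nonneg h1
  exact ⟨z, hz, eq_of_mem_seg_of_dist_eq ((mem_seg_map_iff he).2 hz) hp (by rw [he.dist_eq, hd])⟩

theorem SystemOfIsometries.nonempty {K : Type*} [MetricSpace K] {ι : Type*}
    (S : SystemOfIsometries K ι) (X : InfWord ι) : Nonempty K :=
  (S.source_subtree (X.letter 0).1).1.to_type

namespace AssocTree

variable {K : Type} [MetricSpace K] {ι : Type} [DecidableEq ι]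
  {S : SystemOfIsometries K ι} (A : AssocTree S) {Tc : Type} [MetricSpace Tc]

/-- The map `QK` is the boundary map of the tiles of `A`: the tiles whose index has a long
common prefix with `X` lie in any given direction containing `QK X`. -/
def IsTileLimit (e : A.carrier → Tc) (QK : InfWord ι → TreeHat Tc) : Prop :=
  ∀ (X : InfWord ι) (p x : Tc), SameDir p (QK X) x →
    ∃ i, ∀ g, HasPrefix g X i → ∀ y ∈ A.tile g, SameDir p (Sum.inl (e y)) x

variable {A} {e : A.carrier → Tc} {QK : InfWord ι → TreeHat Tc}

variable [IsRTree Tc]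

theorem IsTileLimit.tendsto (h : A.IsTileLimit e QK) (P : A.carrier) {X : InfWord ι}
    {w : ℕ → FreeGroup ι} (hw : TendstoBoundary w X) :
    Tendsto (fun n => (Sum.inl (e (w n • P)) : TreeHat Tc)) atTop
      (@nhds _ (observersTopology Tc) (QK X)) := by
  refine tendsto_observers_iff.2 fun p x hx => ?_
  obtain ⟨i, hi⟩ := h X p x hx
  obtain ⟨u, k, rfl⟩ := A.orbit_meets P
  filter_upwards [hw (i + u.toWord.length)] with n hn
  refine hi (w n * u) (HasPrefix.mul u hn) _ ?_
  rw [smul_smul]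
  exact A.smul_emb_mem_tile _ _

theorem IsTileLimit.continuous (h : A.IsTileLimit e QK) :
    @Continuous _ _ _ (observersTopology Tc) QK := by
  refine (@continuous_iff_continuousAt _ _ _ (observersTopology Tc) QK).2 fun X => ?_
  refine tendsto_observers_iff.2 fun p x hx => ?_
  obtain ⟨q, x', y', hx', hy', hq⟩ := exists_sameDir_separating hx.ne.symm
  obtain ⟨i, hi⟩ := h X q y' hy'
  obtain ⟨k⟩ := S.nonempty X
  set P := A.emb k
  have hXP := tendsto_observers_iff.1 (h.tendsto P (tendstoBoundary_prefixN X))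
  obtain ⟨n, hn₁, hn₂⟩ := ((hXP p x hx).and (hXP q y' hy')).exists
  generalize e (X.prefixN n • P) = v at hn₁ hn₂
  filter_upwards [eventually_letter_eq X i] with Y hY
  have hYP := tendsto_observers_iff.1 (h.tendsto P (tendstoBoundary_prefixN Y))
  have hYq : ∀ᶠ n in atTop, SameDir q (Sum.inl (e (Y.prefixN n • P))) y' := by
    filter_upwards [eventually_ge_atTop i] with n hn
    exact hi _ ((hasPrefix_prefixN Y hn).congr hY) _ (A.smul_emb_mem_tile _ k)
  by_contra hcon
  by_cases hYp : QK Y = Sum.inl p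
  · obtain ⟨n, h₁, h₂⟩ := ((hYP q x' (hYp.symm ▸ hx')).and hYq).exists
    exact h₁.notMem_seg h₂ hq
  · obtain ⟨z, hz⟩ := exists_sameDir hYp
    have hpz : p ∈ seg z x := by
      by_contra hpz
      exact hcon (hz.trans hpz)
    obtain ⟨n, h₁, h₂⟩ := ((hYP p z hz).and hYq).exists
    generalize e (Y.prefixN n • P) = w at h₁ h₂
    have hpwv : p ∈ seg w v := (mem_seg_congr h₁ hn₁).2 hpz
    have hqpv : q ∈ seg p v := (mem_seg_congr hx' hn₂).2 hq
    rw [seg_comm] at hpwv hqpv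
    exact notMem_seg_trans hn₂ (mt (fun hq' => (seg_comm y' w) ▸ hq') h₂)
      (mem_seg_of_mem_seg_left hpwv hqpv)

theorem IsTileLimit.smul [MulAction (FreeGroup ι) Tc]
    (hiso : ∀ g : FreeGroup ι, Isometry fun x : Tc => g • x)
    (hequiv : ∀ (g : FreeGroup ι) (p : A.carrier), e (g • p) = g • e p)
    (h : A.IsTileLimit e QK) {g : FreeGroup ι} {X Y : InfWord ι} (hXY : SmulBoundary g X Y) :
    QK Y = TreeHat.smul hiso g (QK X) := by
  by_contra hne
  obtain ⟨p, x, y, hx, hy, hp⟩ := exists_sameDir_separating hne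
  have hXp : QK X ≠ Sum.inl (g⁻¹ • p) := by
    intro h'
    refine hy.ne ?_
    rw [h']
    exact congrArg Sum.inl (smul_inv_smul g p)
  obtain ⟨z, hz⟩ := exists_sameDir hXp
  have hz' := hz.smul hiso g
  rw [smul_inv_smul] at hz'
  obtain ⟨k⟩ := S.nonempty X
  have h₁ := tendsto_observers_iff.1 (h.tendsto (A.emb k) hXY) p x hx
  have h₂ := tendsto_observers_iff.1
    (h.tendsto (A.emb k) (tendstoBoundary_prefixN X)) (g⁻¹ • p) z hz
  obtain ⟨n, h₁, h₂⟩ := (h₁.and h₂).exists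
  have h₃ := h₂.smul hiso g
  rw [smul_inv_smul] at h₃
  rw [mul_smul, hequiv] at h₁
  exact SameDir.notMem_seg h₁ (h₃.trans (hz'.notMem_seg hy)) hp

variable [CompactSpace K] [IsRTree K]

theorem exists_tile_of_eventuallyAdmissible (hind : S.IndependentGenerators)
    (he : Isometry e) {X : InfWord ι} {k : ℕ} {q : A.carrier}
    (hq : ∀ n, k ≤ n → q ∈ A.tile (X.prefixN n)) {p x : Tc} (hx : p ∉ seg (e q) x) :
    ∃ i, ∀ g, HasPrefix g X i → ∀ y ∈ A.tile g, p ∉ seg (e y) x := by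
  by_cases hp : ∃ P, e P = p
  · obtain ⟨P, rfl⟩ := hp
    have hne : P ≠ q := by
      rintro rfl
      exact hx (left_mem_seg _ _)
    obtain ⟨i, hi⟩ := A.exists_forall_notMem_seg_of_mem_tile hind hq hne
    refine ⟨i, fun g hg y hy => notMem_seg_trans (y := e q) ?_ hx⟩
    rw [seg_comm, mem_seg_map_iff he]
    exact hi g hg y hy
  · refine ⟨0, fun g _ y _ => notMem_seg_trans (y := e q) (fun h => hp ?_) hx⟩
    obtain ⟨P, -, hP⟩ := exists_mem_seg_of_isometry he h
    exact ⟨P, hP⟩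

theorem exists_tile_of_not_eventuallyAdmissible (he : Isometry e) {X : InfWord ι}
    (hX : ¬ S.EventuallyAdmissible X) {x₀ : A.carrier} (hx₀ : x₀ ∈ A.tile 1)
    {q : ℕ → A.carrier} (hq : ∀ n, q n ∈ A.tile (X.prefixN n))
    (hproj : ∀ n, ∀ z ∈ A.tile (X.prefixN n), q n ∈ seg x₀ z) {p x : Tc}
    (hx : ∀ᶠ n in atTop, p ∉ seg (e (q n)) x) :
    ∃ i, ∀ g, HasPrefix g X i → ∀ y ∈ A.tile g, p ∉ seg (e y) x := by
  obtain ⟨m, hm⟩ := eventually_atTop.1 hx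
  by_cases hp : ∃ P, e P = p
  · obtain ⟨P, rfl⟩ := hp
    obtain ⟨i, hi⟩ := A.exists_forall_notMem_seg_of_proj hX hx₀ hq hproj (p := P) (m := m) (by
      intro n hn
      rw [← mem_seg_map_iff he]
      refine notMem_seg_trans (hm m le_rfl) ?_
      rw [seg_comm]
      exact hm n hn)
    refine ⟨i, fun g hg y hy => notMem_seg_trans (y := e (q m)) ?_ (hm m le_rfl)⟩
    rw [seg_comm, mem_seg_map_iff he]
    exact hi g hg y hy
  · refine ⟨0, fun g _ y _ => notMem_seg_trans (y := e (q m)) (fun h => hp ?_) (hm m le_rfl)⟩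
    obtain ⟨P, -, hP⟩ := exists_mem_seg_of_isometry he h
    exact ⟨P, hP⟩

theorem isTileLimit (hind : S.IndependentGenerators) (he : Isometry e)
    (hadm : ∀ (X : InfWord ι) (k : ℕ) (q : K), S.AdmissibleInf (X.shift k) →
        S.domInf (X.shift k) = {q} → QK X = Sum.inl (e (X.prefixN k • A.emb q)))
    (hnonadm : ∀ X : InfWord ι, ¬ S.EventuallyAdmissible X →
        ∀ Q : ℕ → A.carrier,
          (∀ᶠ i in Filter.atTop, ∃ x : A.carrier,
            IsBridge (Set.range A.emb) (X.prefixN i • Set.range A.emb) x (Q i)) →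
          Filter.Tendsto (fun i => (Sum.inl (e (Q i)) : TreeHat Tc)) Filter.atTop
            (@nhds _ (observersTopology Tc) (QK X))) :
    A.IsTileLimit e QK := by
  intro X p x hx
  by_cases hX : S.EventuallyAdmissible X
  · obtain ⟨k, hk⟩ := hX
    obtain ⟨q, hq⟩ := hind _ hk
    rw [hadm X k q hk hq] at hx
    have hq' := A.mem_domInf_shift.1 (hq ▸ mem_singleton q : q ∈ S.domInf (X.shift k))
    refine exists_tile_of_eventuallyAdmissible hind he (k := k) (fun n hn => ?_) hx
    obtain ⟨m, rfl⟩ := Nat.exists_eq_add_of_le hn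
    exact hq' m
  · obtain ⟨k⟩ := S.nonempty X
    have hne : ∀ g, (A.tile g).Nonempty := fun g => ⟨_, A.smul_emb_mem_tile g k⟩
    have hx₀ : A.emb k ∈ A.tile 1 := A.tile_one ▸ mem_range_self k
    choose q hq hproj using fun n =>
      (A.isSubtree_tile (X.prefixN n)).exists_proj (A.isCompact_tile _) (hne _) (A.emb k)
    refine exists_tile_of_not_eventuallyAdmissible he hX hx₀ hq hproj
      (tendsto_observers_iff.1 (hnonadm X hX q (Eventually.of_forall fun n => ?_)) p x hx)
    obtain ⟨a, ha, haproj⟩ :=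
      (A.isSubtree_tile 1).exists_proj (A.isCompact_tile 1) (hne 1) (q n)
    exact ⟨a, A.isBridge_of_proj hx₀ (hq n) (hproj n) ha haproj⟩

end AssocTree

/-- **Corollary 4.8.**  Let `𝒦 = (K, 𝒜)` be a system of isometries on a compact ℝ-tree
with independent generators, and let `𝒬_𝒦 : ∂F(𝒜) → T̂_𝒦` be the map defined by the two
hypotheses below (on eventually admissible, resp. not eventually admissible, words).
Then `𝒬_𝒦` is `F(𝒜)`-equivariant and continuous (for the observers' topology), and for
every `P ∈ T_𝒦` it is the continuous extension to `F(𝒜) ∪ ∂F(𝒜)` of `w ↦ wP`. -/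
theorem QK_equivariant_continuous (K : Type) [MetricSpace K] [CompactSpace K] [IsRTree K]
    (ι : Type) [Fintype ι] [DecidableEq ι] (S : SystemOfIsometries K ι)
    (hind : S.IndependentGenerators) (A : AssocTree S)
    (Tc : Type) [MetricSpace Tc] [CompleteSpace Tc] (hTc : IsRTree Tc)
    [MulAction (FreeGroup ι) Tc] (hTiso : ∀ g : FreeGroup ι, Isometry fun x : Tc => g • x)
    (e : A.carrier → Tc) (he : Isometry e) (hdense : DenseRange e)
    (hequiv : ∀ (g : FreeGroup ι) (p : A.carrier), e (g • p) = g • e p)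
    (QK : InfWord ι → TreeHat Tc)
    (hadm : ∀ (X : InfWord ι) (k : ℕ) (q : K), S.AdmissibleInf (X.shift k) →
        S.domInf (X.shift k) = {q} → QK X = Sum.inl (e (X.prefixN k • A.emb q)))
    (hnonadm : ∀ X : InfWord ι, ¬ S.EventuallyAdmissible X →
        ∀ Q : ℕ → A.carrier,
          (∀ᶠ i in Filter.atTop, ∃ x : A.carrier,
            IsBridge (Set.range A.emb) (X.prefixN i • Set.range A.emb) x (Q i)) →
          Filter.Tendsto (fun i => (Sum.inl (e (Q i)) : TreeHat Tc)) Filter.atTop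
            (@nhds _ (observersTopology Tc) (QK X))) :
    (∀ (g : FreeGroup ι) (X Y : InfWord ι), SmulBoundary g X Y →
        QK Y = TreeHat.smul hTiso g (QK X)) ∧
    (@Continuous _ _ _ (observersTopology Tc) QK) ∧
    (∀ (P : A.carrier) (X : InfWord ι) (w : ℕ → FreeGroup ι), TendstoBoundary w X →
        Filter.Tendsto (fun n => (Sum.inl (e (w n • P)) : TreeHat Tc)) Filter.atTop
          (@nhds _ (observersTopology Tc) (QK X))) := by
  have h := AssocTree.isTileLimit hind he hadm hnonadm
  exact ⟨fun _ _ _ hXY => h.smul hTiso hequiv hXY, h.continuous, fun P _ _ hw => h.tendsto P hw⟩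

end CHL
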